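/- arXiv:math/0207220 — 3 statements merged into one kernel-verified Lean document; each statement's English description precedes it below -/
import Mathlib

section
/- Let u(x,t) be a twice continuously differentiable divergence-free velocity field on ℝ³, let A(x,t) solve the transport equation ∂ₜA + (u·∇)A = 0 with initial data A(x,0) = x, and let r(x,t) be a scalar function such that the Weber formula uⁱ(x,t) = (∂ᵢA^α(x,t)) u₀^α(A(x,t)) − ∂ᵢr(x,t) + Ω[(e₃; A(x,t); ∂ᵢA(x,t)) − (e₃; x; eᵢ)] holds, where u₀ = u(·,0). Then u solves the rotating Euler equations ∂ₜu + (u·∇)u + ∇π + 2Ω e₃×u = 0 with pressure π = (∂ₜ + u·∇)r + ½|u|² + Ω (e₃; x; u). Conversely, if u is a twice continuously differentiable solution of the rotating Euler equations with X, A its Lagrangian and back-to-labels maps, then there exists a scalar function r such that the Weber formula above holds. -/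
open Real Set MeasureTheory

noncomputable section

/-- The `i`-th standard basis vector of `ℝ³`. -/
def ee (i : Fin 3) : Fin 3 → ℝ := fun j => if j = i then 1 else 0

/-- `det3 u v w` is the determinant of the 3×3 matrix with columns `u`, `v`, `w`. -/
def det3 (u v w : Fin 3 → ℝ) : ℝ :=
  Matrix.det (Matrix.of fun i j => ![u, v, w] j i)

/-- The Levi-Civita symbol `ε_{ijk}`. -/
def lev (i j k : Fin 3) : ℝ := det3 (ee i) (ee j) (ee k)

/-- Cross product in `ℝ³`. -/
def cross (a b : Fin 3 → ℝ) : Fin 3 → ℝ :=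
  ![a 1 * b 2 - a 2 * b 1, a 2 * b 0 - a 0 * b 2, a 0 * b 1 - a 1 * b 0]

/-- Spatial partial derivative `∂ᵢ f (x)` of a scalar function on `ℝ³`. -/
def pd (i : Fin 3) (f : (Fin 3 → ℝ) → ℝ) (x : Fin 3 → ℝ) : ℝ :=
  fderiv ℝ f x (ee i)

/-- A vector field on `ℝ³` is divergence free. -/
def DivFree (v : (Fin 3 → ℝ) → Fin 3 → ℝ) : Prop :=
  ∀ x, ∑ i, pd i (fun y => v y i) x = 0

/-- The curl `∇ × v` of a vector field on `ℝ³`. -/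
def curl (v : (Fin 3 → ℝ) → Fin 3 → ℝ) (x : Fin 3 → ℝ) : Fin 3 → ℝ :=
  ![pd 1 (fun y => v y 2) x - pd 2 (fun y => v y 1) x,
    pd 2 (fun y => v y 0) x - pd 0 (fun y => v y 2) x,
    pd 0 (fun y => v y 1) x - pd 1 (fun y => v y 0) x]

/-- Gradient matrix of a vector field: `grad v x i j = ∂ᵢ vⱼ (x)`. -/
def grad (v : (Fin 3 → ℝ) → Fin 3 → ℝ) (x : Fin 3 → ℝ) : Fin 3 → Fin 3 → ℝ :=
  fun i j => pd i (fun y => v y j) x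

/-- The rotating Euler equations `∂ₜu + (u·∇)u + ∇π + 2Ω e₃ × u = 0` at the point `(x,t)`. -/
def RotEuler (Ω : ℝ) (u : (Fin 3 → ℝ) → ℝ → Fin 3 → ℝ)
    (p : (Fin 3 → ℝ) → ℝ → ℝ) (x : Fin 3 → ℝ) (t : ℝ) : Prop :=
  ∀ i, deriv (fun s => u x s i) t
      + (∑ j, u x t j * pd j (fun y => u y t i) x)
      + pd i (fun y => p y t) x
      + 2 * Ω * cross (ee 2) (u x t) i = 0

/-- `X` is the Lagrangian flow map of the velocity `u`, started at time `t₀`: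
`∂ₜ X(a,t) = u(X(a,t),t)`, `X(a,t₀) = a`. -/
def IsFlowMap (u : (Fin 3 → ℝ) → ℝ → Fin 3 → ℝ)
    (X : (Fin 3 → ℝ) → ℝ → Fin 3 → ℝ) (t₀ : ℝ) : Prop :=
  (∀ a, X a t₀ = a) ∧ ∀ a t, HasDerivAt (fun s => X a s) (u (X a t) t) t

/-- `A` is the back-to-labels map: the inverse of `X(·,t)` for each time `t`. -/
def IsInverseOf (A X : (Fin 3 → ℝ) → ℝ → Fin 3 → ℝ) : Prop :=
  (∀ x t, X (A x t) t = x) ∧ ∀ a t, A (X a t) t = a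

/-- `𝒞(M; w)ᵢ = ½ ε_{ijk} (M_{j·}; M_{k·}; w)`, `M_{j·}` the `j`-th row of `M`. -/
def calC (M : Fin 3 → Fin 3 → ℝ) (w : Fin 3 → ℝ) : Fin 3 → ℝ :=
  fun i => (1/2) * ∑ j, ∑ k, lev i j k * det3 (M j) (M k) w

/-- `A` solves the transport equation `∂ₜA + (u·∇)A = 0` with initial data `A(x,0) = x`. -/
def SolvesTransport (u A : (Fin 3 → ℝ) → ℝ → Fin 3 → ℝ) : Prop :=
  (∀ x, A x 0 = x) ∧
  ∀ x t i, deriv (fun s => A x s i) t + ∑ j, u x t j * pd j (fun y => A y t i) x = 0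

/-- The Weber formula for the rotating Euler equations:
`uⁱ = (∂ᵢA^α) u₀^α(A) − ∂ᵢr + Ω[(e₃; A; ∂ᵢA) − (e₃; x; eᵢ)]`. -/
def Weber (Ω : ℝ) (u A : (Fin 3 → ℝ) → ℝ → Fin 3 → ℝ)
    (r : (Fin 3 → ℝ) → ℝ → ℝ) : Prop :=
  ∀ x t i, u x t i =
    (∑ α, pd i (fun y => A y t α) x * u (A x t) 0 α)
    - pd i (fun y => r y t) x
    + Ω * (det3 (ee 2) (A x t) (fun j => pd i (fun y => A y t j) x)
            - det3 (ee 2) x (ee i))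

/-- The pressure `π = (∂ₜ + u·∇) r + ½|u|² + Ω (e₃; x; u)`. -/
def weberPressure (Ω : ℝ) (u : (Fin 3 → ℝ) → ℝ → Fin 3 → ℝ)
    (r : (Fin 3 → ℝ) → ℝ → ℝ) (x : Fin 3 → ℝ) (t : ℝ) : ℝ :=
  deriv (fun s => r x s) t + (∑ j, u x t j * pd j (fun y => r y t) x)
    + (1/2) * (∑ j, (u x t j)^2) + Ω * det3 (ee 2) x (u x t)


lemma linODE_exists {F : Type*} [NormedAddCommGroup F] [NormedSpace ℝ F] [FiniteDimensional ℝ F]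
    (B : ℝ → F →L[ℝ] F) (hB : ContinuousOn B (Icc 0 1)) (x₀ : F) :
    ∃ α : ℝ → F, α 0 = x₀ ∧
      ∀ t ∈ Icc (0:ℝ) 1, HasDerivWithinAt α (B t (α t)) (Icc 0 1) t := by
  have : CompleteSpace F := FiniteDimensional.complete ℝ F
  obtain ⟨M, hM⟩ := isCompact_Icc.exists_bound_of_continuousOn hB
  have hM0 : 0 ≤ M := (norm_nonneg _).trans (hM 0 (by simp))
  set R : ℝ := ‖x₀‖ * Real.exp M + 1 with hR
  have hRpos : 0 < R := by positivity
  let χ : ContDiffBump (0 : F) := ⟨R, R + 1, hRpos, by linarith⟩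
  let ρ : F → F := fun y => χ y • y
  have hρ1 : ContDiff ℝ 1 ρ := χ.contDiff.smul contDiff_id
  have hρc : HasCompactSupport ρ := χ.hasCompactSupport.smul_right
  obtain ⟨K, hK⟩ := hρ1.lipschitzWith_of_hasCompactSupport hρc (by norm_num)
  obtain ⟨N, hN⟩ := hρ1.continuous.bounded_above_of_compact_support hρc
  have hN0 : 0 ≤ N := (norm_nonneg _).trans (hN 0)
  have hρid : ∀ y, ‖y‖ ≤ R → ρ y = y := by
    intro y hy
    have : χ y = 1 := χ.one_of_mem_closedBall (by simpa using! hy)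
    simp [ρ, this]
  have hρle : ∀ y, ‖ρ y‖ ≤ ‖y‖ := by
    intro y
    simp only [ρ, norm_smul, Real.norm_eq_abs, abs_of_nonneg χ.nonneg]
    exact mul_le_of_le_one_left (norm_nonneg _) χ.le_one
  have hPL : IsPicardLindelof (fun t y => B t (ρ y)) (tmin := 0) (tmax := 1) ⟨0, by simp⟩ x₀
      (⟨M * N, by positivity⟩) 0 (⟨M * N, by positivity⟩) (⟨M, hM0⟩ * K) := by
    refine ⟨?_, ?_, ?_, ?_⟩
    · intro t ht
      have h1 : LipschitzWith ⟨M, hM0⟩ (B t) :=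
        (B t).lipschitz.weaken (by exact_mod_cast hM t ht)
      exact (h1.comp hK).lipschitzOnWith
    · intro x _
      exact hB.clm_apply continuousOn_const
    · intro t ht x _
      exact ((B t).le_opNorm _).trans (mul_le_mul (hM t ht) (hN _) (norm_nonneg _) hM0)
    · simp
  obtain ⟨α, h0, hα⟩ := hPL.exists_eq_forall_mem_Icc_hasDerivWithinAt₀
  have hbd : ∀ t ∈ Icc (0:ℝ) 1, ‖α t‖ ≤ gronwallBound ‖x₀‖ M 0 (t - 0) := by
    apply norm_le_gronwallBound_of_norm_deriv_right_le (f' := fun t => B t (ρ (α t)))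
    · exact fun t ht => (hα t ht).continuousWithinAt
    · intro t ht
      exact (hα t (Ico_subset_Icc_self ht)).mono_of_mem_nhdsWithin
        (Filter.mem_of_superset (Icc_mem_nhdsGE ht.2) (Icc_subset_Icc_left ht.1))
    · exact h0 ▸ le_rfl
    · intro t ht
      rw [add_zero]
      exact ((B t).le_opNorm _).trans
        (mul_le_mul (hM t (Ico_subset_Icc_self ht)) (hρle _) (norm_nonneg _) hM0)
  refine ⟨α, h0, fun t ht => ?_⟩
  have h2 := hbd t ht
  rw [gronwallBound_ε0, sub_zero] at h2
  have h3 : Real.exp (M * t) ≤ Real.exp M :=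
    Real.exp_le_exp.2 (mul_le_of_le_one_right hM0 ht.2)
  have h4 : ‖α t‖ ≤ R := by
    have := mul_le_mul_of_nonneg_left h3 (norm_nonneg x₀)
    linarith
  have := hα t ht
  simp only [hρid _ h4] at this
  exact this

lemma gronwallBound_zero_le {M e s : ℝ} (hM : 1 ≤ M) (he : 0 ≤ e) (hs : s ∈ Icc (0:ℝ) 1) :
    gronwallBound 0 M e s ≤ e * Real.exp M := by
  rw [gronwallBound_of_K_ne_0 (by linarith)]
  have h3 : Real.exp (M * s) ≤ Real.exp M :=
    Real.exp_le_exp.2 (mul_le_of_le_one_right (by linarith) hs.2)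
  have h4 : 0 ≤ Real.exp (M * s) - 1 := by
    have := Real.one_le_exp (x := M * s) (mul_nonneg (by linarith) hs.1)
    linarith
  have h5 : e / M ≤ e := div_le_self he hM
  have h6 := mul_le_mul h5 (sub_le_sub_right h3 1) h4 he
  linarith

/-- Differentiable dependence on initial data on `[0,1]`. -/
lemma flow_diff {E G : Type*} [NormedAddCommGroup E] [NormedSpace ℝ E] [FiniteDimensional ℝ E]
    [NormedAddCommGroup G] [NormedSpace ℝ G] [FiniteDimensional ℝ G]
    (f : ℝ → E → E) (f' : ℝ → E → E →L[ℝ] E)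
    (hf : ∀ s y, HasFDerivAt (f s) (f' s y) y)
    (hf' : Continuous (fun q : ℝ × E => f' q.1 q.2))
    (Y : G → ℝ → E) (hY : ∀ x s, HasDerivAt (Y x) (f s (Y x s)) s)
    (ι : G →L[ℝ] E) (hι : ∀ x, Y x 0 = ι x) (x₀ : G) :
    ∃ Φ : ℝ → G →L[ℝ] E, Φ 0 = ι ∧
      (∀ s ∈ Icc (0:ℝ) 1, HasDerivWithinAt Φ ((f' s (Y x₀ s)).comp (Φ s)) (Icc 0 1) s) ∧
      ∀ s ∈ Icc (0:ℝ) 1, HasFDerivAt (fun x => Y x s) (Φ s) x₀ := by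
  have : ProperSpace E := FiniteDimensional.proper ℝ E
  have hYc : ∀ x, Continuous (Y x) :=
    fun x => continuous_iff_continuousAt.2 fun s => (hY x s).continuousAt
  obtain ⟨R, hR⟩ := (isCompact_Icc (a := (0:ℝ)) (b := 1)).exists_bound_of_continuousOn
    (hYc x₀).continuousOn
  have hcomp : IsCompact (Icc (0:ℝ) 1 ×ˢ Metric.closedBall (0:E) (R + 1)) :=
    isCompact_Icc.prod (isCompact_closedBall _ _)
  obtain ⟨M₀, hM₀⟩ := hcomp.exists_bound_of_continuousOn hf'.continuousOn
  set M : ℝ := max M₀ 1 with hMdef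
  have hM1 : 1 ≤ M := le_max_right _ _
  have hM0 : 0 ≤ M := by linarith
  have hM : ∀ s ∈ Icc (0:ℝ) 1, ∀ y ∈ Metric.closedBall (0:E) (R + 1), ‖f' s y‖ ≤ M :=
    fun s hs y hy => (hM₀ (s, y) ⟨hs, hy⟩).trans (le_max_left _ _)
  have hmem : ∀ s ∈ Icc (0:ℝ) 1, ∀ y, dist (Y x₀ s) y ≤ 1 → y ∈ Metric.closedBall (0:E) (R+1) := by
    intro s hs y hy
    rw [mem_closedBall_zero_iff]
    have h1 := hR s hs
    have h2 : ‖y‖ ≤ ‖Y x₀ s‖ + ‖Y x₀ s - y‖ := by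
      have := norm_sub_le (Y x₀ s) (Y x₀ s - y)
      simpa using this
    rw [dist_eq_norm] at hy
    linarith
  have hLip : ∀ s ∈ Icc (0:ℝ) 1, LipschitzOnWith ⟨M, hM0⟩ (f s) (Metric.closedBall (0:E) (R + 1)) := by
    intro s hs
    exact (convex_closedBall _ _).lipschitzOnWith_of_nnnorm_hasFDerivWithin_le
      (fun y hy => (hf s y).hasFDerivWithinAt) (fun y hy => by exact_mod_cast hM s hs y hy)
  -- bootstrap
  have hgr : ∀ x, ∀ b ∈ Icc (0:ℝ) 1, (∀ s ∈ Ico (0:ℝ) b, dist (Y x₀ s) (Y x s) ≤ 1) →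
      ∀ s ∈ Icc (0:ℝ) b, dist (Y x₀ s) (Y x s) ≤ dist (ι x₀) (ι x) * Real.exp M := by
    intro x b hb hh s hs
    have key := dist_le_of_trajectories_ODE_of_mem (v := f) (K := ⟨M, hM0⟩) (a := 0) (b := b)
      (s := fun _ => Metric.closedBall (0:E) (R + 1)) (f := Y x₀) (g := Y x)
      (δ := dist (ι x₀) (ι x))
      (fun t ht => hLip t ⟨ht.1, ht.2.le.trans hb.2⟩) (hYc x₀).continuousOn
      (fun t _ => (hY x₀ t).hasDerivWithinAt)
      (fun t ht => hmem t ⟨ht.1, ht.2.le.trans hb.2⟩ _ (by simp))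
      (hYc x).continuousOn (fun t _ => (hY x t).hasDerivWithinAt)
      (fun t ht => hmem t ⟨ht.1, ht.2.le.trans hb.2⟩ _ (hh t ht))
      (by rw [hι, hι]) s hs
    refine key.trans (mul_le_mul_of_nonneg_left (Real.exp_le_exp.2 ?_) dist_nonneg)
    rw [sub_zero]
    exact mul_le_of_le_one_right hM0 (hs.2.trans hb.2)
  have hboot : ∀ x, dist (ι x₀) (ι x) * Real.exp M < 1 → ∀ s ∈ Icc (0:ℝ) 1,
      dist (Y x₀ s) (Y x s) ≤ dist (ι x₀) (ι x) * Real.exp M := by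
    intro x hx
    have hgc : Continuous fun s => dist (Y x₀ s) (Y x s) := (hYc x₀).dist (hYc x)
    have hlt : ∀ s ∈ Icc (0:ℝ) 1, dist (Y x₀ s) (Y x s) < 1 := by
      by_contra hcon
      push Not at hcon
      set S : Set ℝ := Icc (0:ℝ) 1 ∩ {s | 1 ≤ dist (Y x₀ s) (Y x s)} with hS
      have hSne : S.Nonempty := by
        obtain ⟨s, hs, h⟩ := hcon
        exact ⟨s, hs, h⟩
      have hSc : IsCompact S := isCompact_Icc.inter_right (isClosed_le continuous_const hgc)
      obtain ⟨b, hb, hbmin⟩ := hSc.exists_isLeast hSne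
      have := hgr x b hb.1 (fun s hs => by
        by_contra hc
        push Not at hc
        have := hbmin (⟨⟨hs.1, hs.2.le.trans hb.1.2⟩, hc.le⟩ : s ∈ S)
        exact absurd hs.2 (not_lt.2 this)) b ⟨hb.1.1, le_rfl⟩
      have h2 : 1 ≤ dist (Y x₀ b) (Y x b) := hb.2
      linarith
    exact hgr x 1 (by simp) (fun s hs => (hlt s (Ico_subset_Icc_self hs)).le)
  have hBc : Continuous fun s => f' s (Y x₀ s) :=
    hf'.comp (continuous_id.prodMk (hYc x₀))
  obtain ⟨Φ, hΦ0, hΦ⟩ := linODE_exists (F := G →L[ℝ] E)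
    (fun s => ContinuousLinearMap.compL ℝ G E E (f' s (Y x₀ s)))
    ((ContinuousLinearMap.compL ℝ G E E).continuous.comp hBc).continuousOn ι
  refine ⟨Φ, hΦ0, fun s hs => by simpa using! hΦ s hs, fun s₁ hs₁ => ?_⟩
  rw [hasFDerivAt_iff_isLittleO_nhds_zero, Asymptotics.isLittleO_iff]
  intro c hc
  set C : ℝ := (‖ι‖ + 1) * Real.exp M with hC
  have hCpos : 0 < C := by positivity
  set ε : ℝ := c / (C * Real.exp M) with hε
  have hεpos : 0 < ε := by positivity
  -- uniform continuity
  have huc := hcomp.uniformContinuousOn_of_continuous hf'.continuousOn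
  rw [Metric.uniformContinuousOn_iff_le] at huc
  obtain ⟨η, hη, huc⟩ := huc ε hεpos
  have hnear : ∀ s ∈ Icc (0:ℝ) 1, ∀ y, dist (Y x₀ s) y ≤ min η 1 →
      ‖f s y - f s (Y x₀ s) - f' s (Y x₀ s) (y - Y x₀ s)‖ ≤ ε * ‖y - Y x₀ s‖ := by
    intro s hs y hy
    refine (convex_closedBall (Y x₀ s) (min η 1)).norm_image_sub_le_of_norm_hasFDerivWithin_le'
      (fun z _ => (hf s z).hasFDerivWithinAt) ?_ ?_ ?_
    · intro z hz
      rw [Metric.mem_closedBall, dist_comm] at hz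
      have h1 : ((s, z) : ℝ × E) ∈ Icc (0:ℝ) 1 ×ˢ Metric.closedBall (0:E) (R + 1) :=
        ⟨hs, hmem s hs z (hz.trans (min_le_right _ _))⟩
      have h2 : ((s, Y x₀ s) : ℝ × E) ∈ Icc (0:ℝ) 1 ×ˢ Metric.closedBall (0:E) (R + 1) :=
        ⟨hs, hmem s hs _ (by simp)⟩
      have := huc _ h1 _ h2 (by
        rw [Prod.dist_eq]
        simp only [dist_self]
        rw [dist_comm z]
        exact max_le hη.le (hz.trans (min_le_left _ _)))
      rwa [dist_eq_norm] at this
    · exact Metric.mem_closedBall_self (by positivity)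
    · rwa [Metric.mem_closedBall, dist_comm]
  have hev : ∀ᶠ h : G in nhds 0, ‖h‖ < min η 1 / C := by
    have : Metric.ball (0:G) (min η 1 / C) ∈ nhds (0:G) :=
      Metric.ball_mem_nhds _ (by positivity)
    filter_upwards [this] with h hh
    simpa using! hh
  filter_upwards [hev] with h hh
  have hd0 : dist (ι x₀) (ι (x₀ + h)) * Real.exp M ≤ C * ‖h‖ := by
    rw [dist_eq_norm, ← map_sub, hC]
    have h1 := ι.le_opNorm (x₀ - (x₀ + h))
    have h2 : ‖x₀ - (x₀ + h)‖ = ‖h‖ := by simp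
    rw [h2] at h1
    have : ‖ι (x₀ - (x₀ + h))‖ ≤ (‖ι‖ + 1) * ‖h‖ := by nlinarith [norm_nonneg h]
    nlinarith [Real.exp_pos M]
  have hCh : C * ‖h‖ < min η 1 := by
    rw [lt_div_iff₀ hCpos] at hh
    linarith
  have hdist : ∀ s ∈ Icc (0:ℝ) 1, dist (Y x₀ s) (Y (x₀ + h) s) ≤ C * ‖h‖ := fun s hs =>
    (hboot (x₀ + h) (by linarith [min_le_right η 1]) s hs).trans hd0
  have hfin := norm_le_gronwallBound_of_norm_deriv_right_le (a := 0) (b := 1)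
    (f := fun s => Y (x₀ + h) s - Y x₀ s - Φ s h)
    (f' := fun s => f s (Y (x₀ + h) s) - f s (Y x₀ s) - (f' s (Y x₀ s)) (Φ s h))
    (δ := 0) (K := M) (ε := ε * (C * ‖h‖)) ?_ ?_ ?_ ?_ s₁ hs₁
  · rw [sub_zero] at hfin
    refine hfin.trans ((gronwallBound_zero_le hM1 (by positivity) hs₁).trans (le_of_eq ?_))
    rw [hε]; field_simp
  · have : ContinuousOn Φ (Icc 0 1) := fun t ht => (hΦ t ht).continuousWithinAt
    exact (((hYc _).sub (hYc _)).continuousOn).sub (this.clm_apply continuousOn_const)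
  · intro t ht
    have h1 := (hΦ t (Ico_subset_Icc_self ht)).mono_of_mem_nhdsWithin
        (Filter.mem_of_superset (Icc_mem_nhdsGE ht.2) (Icc_subset_Icc_left ht.1))
    have h2 := h1.clm_apply (hasDerivWithinAt_const t (Ici t) h)
    have h3 := (((hY (x₀ + h) t).sub (hY x₀ t)).hasDerivWithinAt (s := Ici t)).sub h2
    simpa using! h3
  · simp [hι, hΦ0]
  · intro t ht
    have ht' := Ico_subset_Icc_self ht
    have h1 := hnear t ht' (Y (x₀ + h) t) ((hdist t ht').trans hCh.le)
    have h2 : f t (Y (x₀ + h) t) - f t (Y x₀ t) - (f' t (Y x₀ t)) (Φ t h)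
        = (f t (Y (x₀ + h) t) - f t (Y x₀ t) - f' t (Y x₀ t) (Y (x₀ + h) t - Y x₀ t))
          + f' t (Y x₀ t) (Y (x₀ + h) t - Y x₀ t - Φ t h) := by
      simp only [map_sub]; abel
    rw [h2]
    have h3 := hdist t ht'
    rw [dist_comm, dist_eq_norm] at h3
    have h4 := (f' t (Y x₀ t)).le_opNorm (Y (x₀ + h) t - Y x₀ t - Φ t h)
    have h5 := hM t ht' (Y x₀ t) (hmem t ht' _ (by simp))
    have h6 := mul_le_mul_of_nonneg_right h5 (norm_nonneg (Y (x₀ + h) t - Y x₀ t - Φ t h))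
    have h7 := mul_le_mul_of_nonneg_left h3 hεpos.le
    refine (norm_add_le _ _).trans ?_
    linarith

lemma det3_e2 (x v : Fin 3 → ℝ) : det3 (ee 2) x v = x 0 * v 1 - x 1 * v 0 := by
  simp [det3, ee, Matrix.det_fin_three]
  ring

lemma cross_e2 (v : Fin 3 → ℝ) (i : Fin 3) :
    cross (ee 2) v i = v 0 * ee i 1 - v 1 * ee i 0 := by
  fin_cases i <;> simp [cross, ee]

lemma sum_ee (v : Fin 3 → ℝ) : v = ∑ j, v j • ee j := by
  ext k
  fin_cases k <;> simp [ee]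

lemma clm_sum {F : Type*} [NormedAddCommGroup F] [NormedSpace ℝ F]
    (T : (Fin 3 → ℝ) →L[ℝ] F) (v : Fin 3 → ℝ) : T v = ∑ j, v j • T (ee j) := by
  conv_lhs => rw [sum_ee v]
  simp

lemma clm_sum_prod {F : Type*} [NormedAddCommGroup F] [NormedSpace ℝ F]
    (T : ((Fin 3 → ℝ) × ℝ) →L[ℝ] F) (v : Fin 3 → ℝ) :
    T (v, 0) = ∑ j, v j • T (ee j, 0) := by
  simpa using! clm_sum (T.comp (ContinuousLinearMap.inl ℝ (Fin 3 → ℝ) ℝ)) v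

lemma clm_mat {F : Type*} [NormedAddCommGroup F] [NormedSpace ℝ F]
    (T : ((Fin 3 → ℝ) × ℝ) →L[ℝ] F) (v : Fin 3 → ℝ) :
    T (v, 1) = T (0, 1) + ∑ j, v j • T (ee j, 0) := by
  rw [← clm_sum_prod, ← map_add]; simp

lemma hasFDerivAt_slice {F : Type*} [NormedAddCommGroup F] [NormedSpace ℝ F]
    {g : (Fin 3 → ℝ) × ℝ → F} {g' : ((Fin 3 → ℝ) × ℝ) →L[ℝ] F} {x : Fin 3 → ℝ} {t : ℝ}
    (h : HasFDerivAt g g' (x, t)) :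
    HasFDerivAt (fun y => g (y, t)) (g'.comp (ContinuousLinearMap.inl ℝ _ ℝ)) x := by
  have h2 : HasFDerivAt (fun y : Fin 3 → ℝ => (y, t)) (ContinuousLinearMap.inl ℝ _ ℝ) x :=
    hasFDerivAt_prodMk_left x t
  exact HasFDerivAt.comp x h h2

lemma pd_slice {g : (Fin 3 → ℝ) × ℝ → ℝ} {x : Fin 3 → ℝ} {t : ℝ}
    (h : DifferentiableAt ℝ g (x, t)) (j : Fin 3) :
    pd j (fun y => g (y, t)) x = fderiv ℝ g (x, t) (ee j, 0) := by
  rw [pd, (hasFDerivAt_slice h.hasFDerivAt).fderiv]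
  simp

lemma deriv_slice {g : (Fin 3 → ℝ) × ℝ → ℝ} {x : Fin 3 → ℝ} {t : ℝ}
    (h : DifferentiableAt ℝ g (x, t)) :
    deriv (fun s => g (x, s)) t = fderiv ℝ g (x, t) (0, 1) := by
  have h2 : HasDerivAt (fun s : ℝ => (x, s)) ((0 : Fin 3 → ℝ), (1:ℝ)) t :=
    (hasDerivAt_const t x).prodMk (hasDerivAt_id t)
  exact (HasFDerivAt.comp_hasDerivAt t h.hasFDerivAt h2).deriv

lemma weber_part1 (Ω : ℝ) (u : (Fin 3 → ℝ) → ℝ → Fin 3 → ℝ)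
    (hu : ContDiff ℝ 2 (fun q : (Fin 3 → ℝ) × ℝ => u q.1 q.2))
    (A : (Fin 3 → ℝ) → ℝ → Fin 3 → ℝ) (r : (Fin 3 → ℝ) → ℝ → ℝ)
    (hA : ContDiff ℝ 2 (fun q : (Fin 3 → ℝ) × ℝ => A q.1 q.2))
    (hr : ContDiff ℝ 2 (fun q : (Fin 3 → ℝ) × ℝ => r q.1 q.2))
    (hT : SolvesTransport u A) (hW : Weber Ω u A r) (x : Fin 3 → ℝ) (t : ℝ) :
    RotEuler Ω u (weberPressure Ω u r) x t := by
  set U : (Fin 3 → ℝ) × ℝ → Fin 3 → ℝ := fun q => u q.1 q.2 with hU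
  set AA : (Fin 3 → ℝ) × ℝ → Fin 3 → ℝ := fun q => A q.1 q.2 with hAA
  set rr : (Fin 3 → ℝ) × ℝ → ℝ := fun q => r q.1 q.2 with hrr
  have hu' : ∀ i, ContDiff ℝ 2 (fun q => U q i) := fun i => contDiff_pi.1 hu i
  have hA' : ∀ i, ContDiff ℝ 2 (fun q => AA q i) := fun i => contDiff_pi.1 hA i
  have hud : ∀ i, Differentiable ℝ (fun q => U q i) := fun i => (hu' i).differentiable (by norm_num)
  have hAd : ∀ i, Differentiable ℝ (fun q => AA q i) := fun i => (hA' i).differentiable (by norm_num)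
  have hrd : Differentiable ℝ rr := hr.differentiable (by norm_num)
  have hUd : Differentiable ℝ U := hu.differentiable (by norm_num)
  -- second derivatives
  have hsnd : ∀ g : (Fin 3 → ℝ) × ℝ → ℝ, ContDiff ℝ 2 g → Differentiable ℝ (fderiv ℝ g) :=
    fun g hg => (hg.fderiv_right (m := 1) (by norm_num)).differentiable (by norm_num)
  have hsym : ∀ g : (Fin 3 → ℝ) × ℝ → ℝ, ContDiff ℝ 2 g → ∀ q v w,
      fderiv ℝ (fderiv ℝ g) q v w = fderiv ℝ (fderiv ℝ g) q w v := by
    intro g hg q v w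
    exact second_derivative_symmetric
      (fun y => (hg.differentiable (by norm_num) y).hasFDerivAt) (hsnd g hg q).hasFDerivAt v w
  have hpdA : ∀ y s i α, pd i (fun y => A y s α) y = fderiv ℝ (fun q => AA q α) (y, s) (ee i, 0) :=
    fun y s i α => pd_slice (g := fun q => AA q α) (hAd α _) i
  have hpdU : ∀ y s i α, pd i (fun y => u y s α) y = fderiv ℝ (fun q => U q α) (y, s) (ee i, 0) :=
    fun y s i α => pd_slice (g := fun q => U q α) (hud α _) i
  have hpdr : ∀ y s i, pd i (fun y => r y s) y = fderiv ℝ rr (y, s) (ee i, 0) :=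
    fun y s i => pd_slice (g := rr) (hrd _) i
  -- transport
  have hT' : ∀ q α, fderiv ℝ (fun q => AA q α) q (U q, 1) = 0 := by
    rintro ⟨y, s⟩ α
    have := hT.2 y s α
    rw [deriv_slice (g := fun q => AA q α) (hAd α _)] at this
    rw [clm_mat]
    refine Eq.trans ?_ this
    congr 1
    refine Finset.sum_congr rfl fun j _ => ?_
    rw [hpdA]
    rfl
  set W : (Fin 3 → ℝ) × ℝ → (Fin 3 → ℝ) × ℝ := fun q => (U q, 1) with hWdef
  have hWd : ∀ q, HasFDerivAt W ((fderiv ℝ U q).prod 0) q :=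
    fun q => (hUd q).hasFDerivAt.prodMk (hasFDerivAt_const _ _)
  have hcomm : ∀ g : (Fin 3 → ℝ) × ℝ → ℝ, ContDiff ℝ 2 g → ∀ q w,
      fderiv ℝ (fun q => fderiv ℝ g q (W q)) q w
        = fderiv ℝ (fderiv ℝ g) q w (W q) + fderiv ℝ g q (fderiv ℝ U q w, 0) := by
    intro g hg q w
    have := ((hsnd g hg q).hasFDerivAt.clm_apply (hWd q)).fderiv
    rw [this]
    simp [add_comm]
  have hUcomp : ∀ q w j, fderiv ℝ U q w j = fderiv ℝ (fun q => U q j) q w := by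
    intro q w j
    rw [fderiv_apply (hUd q)]
    rfl
  -- β
  let β : Fin 3 → (Fin 3 → ℝ) → ℝ := fun α a => U (a, 0) α + Ω * (a 0 * ee α 1 - a 1 * ee α 0)
  have hβd : ∀ α, Differentiable ℝ (β α) := by
    intro α
    have h1 : Differentiable ℝ fun a : Fin 3 → ℝ => U (a, 0) α :=
      (hud α).comp (by fun_prop : Differentiable ℝ fun a : Fin 3 → ℝ => (a, (0:ℝ)))
    have h2 : Differentiable ℝ fun a : Fin 3 → ℝ => Ω * (a 0 * ee α 1 - a 1 * ee α 0) := by fun_prop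
    exact h1.add h2
  have hAAd : Differentiable ℝ AA := hA.differentiable (by norm_num)
  have hTA : ∀ q, fderiv ℝ AA q (W q) = 0 := by
    intro q
    ext α
    have := hT' q α
    rw [fderiv_apply (hAAd q)] at this
    exact this
  have hβA : ∀ q α, HasFDerivAt (fun q => β α (AA q)) ((fderiv ℝ (β α) (AA q)).comp (fderiv ℝ AA q)) q :=
    fun q α => (hβd α (AA q)).hasFDerivAt.comp q (hAAd q).hasFDerivAt
  -- Weber in terms of β
  have hWb : ∀ i q, U q i + Ω * (q.1 0 * ee i 1 - q.1 1 * ee i 0) + fderiv ℝ rr q (ee i, 0)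
      = ∑ α, fderiv ℝ (fun q => AA q α) q (ee i, 0) * β α (AA q) := by
    rintro i ⟨y, s⟩
    have := hW y s i
    rw [hpdr, det3_e2, det3_e2] at this
    simp only [hpdA] at this
    simp only [Fin.sum_univ_three] at this ⊢
    have e1 : U (y, s) i = u y s i := rfl
    rw [e1, this]
    simp [β, ee, hU, hAA]
    ring
  set q₀ : (Fin 3 → ℝ) × ℝ := (x, t) with hq₀
  intro i
  -- derivative of Weber in direction W
  have key : fderiv ℝ (fun q => U q i) q₀ (W q₀) + Ω * (U q₀ 0 * ee i 1 - U q₀ 1 * ee i 0)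
      + fderiv ℝ (fderiv ℝ rr) q₀ (W q₀) (ee i, 0)
      = ∑ α, fderiv ℝ (fderiv ℝ (fun q => AA q α)) q₀ (W q₀) (ee i, 0) * β α (AA q₀) := by
    have hfun := funext (hWb i)
    have hx : ∀ k, HasFDerivAt (fun q : (Fin 3 → ℝ) × ℝ => q.1 k)
        ((ContinuousLinearMap.proj k).comp (ContinuousLinearMap.fst ℝ (Fin 3 → ℝ) ℝ)) q₀ :=
      fun k => ((ContinuousLinearMap.proj (R := ℝ) (φ := fun _ : Fin 3 => ℝ) k).comp
        (ContinuousLinearMap.fst ℝ (Fin 3 → ℝ) ℝ)).hasFDerivAt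
    have hL := (((hud i q₀).hasFDerivAt).add
      ((((hx 0).mul_const (ee i 1)).sub ((hx 1).mul_const (ee i 0))).const_mul Ω)).add
      ((hsnd rr hr q₀).hasFDerivAt.clm_apply (hasFDerivAt_const ((ee i, 0) : (Fin 3 → ℝ) × ℝ) q₀))
    have hR := HasFDerivAt.fun_sum (u := Finset.univ) (x := q₀) (fun α (_ : α ∈ Finset.univ) =>
      (((hsnd _ (hA' α) q₀).hasFDerivAt.clm_apply
        (hasFDerivAt_const ((ee i, 0) : (Fin 3 → ℝ) × ℝ) q₀)).mul (hβA q₀ α)))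
    have hfun2 := hL.unique (hfun ▸ hR)
    have := congrArg (fun T => T (W q₀)) hfun2
    simp [hTA] at this
    simp [hWdef] at this ⊢
    simp only [mul_comm] at this ⊢
    linarith
  have hAswap : ∀ α, fderiv ℝ (fderiv ℝ (fun q => AA q α)) q₀ (W q₀) (ee i, 0)
      = - ∑ j, fderiv ℝ (fun q => U q j) q₀ (ee i, 0) * fderiv ℝ (fun q => AA q α) q₀ (ee j, 0) := by
    intro α
    have h1 := hcomm _ (hA' α) q₀ (ee i, 0)
    have h2 : (fun q => fderiv ℝ (fun q => AA q α) q (W q)) = fun _ => 0 := funext fun q => hT' q α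
    rw [h2, clm_sum_prod (fderiv ℝ (fun q => AA q α) q₀), hsym _ (hA' α)] at h1
    simp only [hUcomp, smul_eq_mul] at h1
    simp at h1
    linarith
  -- pressure
  have hpr : (fun y => weberPressure Ω u r y t) = fun y => (fun q : (Fin 3 → ℝ) × ℝ =>
      fderiv ℝ rr q (W q) + (1/2) * ∑ j, (U q j)^2 + Ω * (q.1 0 * U q 1 - q.1 1 * U q 0)) (y, t) := by
    funext y
    simp only [weberPressure, det3_e2]
    rw [deriv_slice (g := rr) (hrd _)]
    simp only [hpdr]
    simp only [hWdef]
    rw [clm_mat (fderiv ℝ rr (y, t)) (U (y, t))]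
    rfl
  have hpd : pd i (fun y => weberPressure Ω u r y t) x =
      fderiv ℝ (fderiv ℝ rr) q₀ (W q₀) (ee i, 0)
      + ∑ j, fderiv ℝ (fun q => U q j) q₀ (ee i, 0) * fderiv ℝ rr q₀ (ee j, 0)
      + ∑ j, U q₀ j * fderiv ℝ (fun q => U q j) q₀ (ee i, 0)
      + Ω * (ee i 0 * U q₀ 1 + x 0 * fderiv ℝ (fun q => U q 1) q₀ (ee i, 0)
        - ee i 1 * U q₀ 0 - x 1 * fderiv ℝ (fun q => U q 0) q₀ (ee i, 0)) := by
    have hx : ∀ k, HasFDerivAt (fun q : (Fin 3 → ℝ) × ℝ => q.1 k)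
        ((ContinuousLinearMap.proj k).comp (ContinuousLinearMap.fst ℝ (Fin 3 → ℝ) ℝ)) q₀ :=
      fun k => ((ContinuousLinearMap.proj (R := ℝ) (φ := fun _ : Fin 3 => ℝ) k).comp
        (ContinuousLinearMap.fst ℝ (Fin 3 → ℝ) ℝ)).hasFDerivAt
    have h1 := (hsnd rr hr q₀).hasFDerivAt.clm_apply (hWd q₀)
    have h2 := HasFDerivAt.fun_sum (u := Finset.univ) (x := q₀) (fun j (_ : j ∈ Finset.univ) =>
      (hud j q₀).hasFDerivAt.pow 2)
    have h3 := (((hx 0).mul (hud 1 q₀).hasFDerivAt).sub ((hx 1).mul (hud 0 q₀).hasFDerivAt)).const_mul Ω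
    have h4 := (h1.add (h2.const_mul (1/2))).add h3
    rw [hpr, pd_slice (g := fun q : (Fin 3 → ℝ) × ℝ =>
      fderiv ℝ rr q (W q) + (1/2) * ∑ j, (U q j)^2 + Ω * (q.1 0 * U q 1 - q.1 1 * U q 0))
      h4.differentiableAt]
    have h5 := h4.fderiv
    have h6 := congrArg (fun T => T (ee i, (0:ℝ))) h5
    refine h6.trans ?_
    simp [Fin.sum_univ_three]
    rw [hsym rr hr, clm_sum_prod (fderiv ℝ rr q₀)]
    simp only [hUcomp, Fin.sum_univ_three, smul_eq_mul]
    simp [hq₀]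
    ring
  have hDt : deriv (fun s => u x s i) t + ∑ j, u x t j * pd j (fun y => u y t i) x
      = fderiv ℝ (fun q => U q i) q₀ (W q₀) := by
    rw [deriv_slice (g := fun q => U q i) (hud i _)]
    simp only [hpdU]
    simp only [hWdef]
    rw [clm_mat (fderiv ℝ (fun q => U q i) q₀) (U q₀)]
    rfl
  rw [hDt, hpd, cross_e2]
  simp only [hAswap] at key
  have w0 := hWb 0 q₀
  have w1 := hWb 1 q₀
  have w2 := hWb 2 q₀
  have e0 : (ee 0 0, ee 0 1) = ((1:ℝ), (0:ℝ)) := by simp [ee]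
  have e1 : (ee 1 0, ee 1 1) = ((0:ℝ), (1:ℝ)) := by simp [ee]
  have e2 : (ee 2 0, ee 2 1) = ((0:ℝ), (0:ℝ)) := by simp [ee]
  simp only [Prod.mk.injEq] at e0 e1 e2
  rw [e0.1, e0.2] at w0
  rw [e1.1, e1.2] at w1
  rw [e2.1, e2.2] at w2
  simp only [Fin.sum_univ_three] at key w0 w1 w2 ⊢
  have eU : ∀ k, u x t k = U q₀ k := fun k => rfl
  have ex : ∀ k, q₀.1 k = x k := fun k => rfl
  simp only [eU, ex] at *
  linear_combination key + fderiv ℝ (fun q => U q 0) q₀ (ee i, 0) * w0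
    + fderiv ℝ (fun q => U q 1) q₀ (ee i, 0) * w1
    + fderiv ℝ (fun q => U q 2) q₀ (ee i, 0) * w2

lemma curl_sym (p : (Fin 3 → ℝ) → ℝ) (ω : (Fin 3 → ℝ) → (Fin 3 → ℝ) →L[ℝ] ℝ)
    (hω : ContDiff ℝ 1 ω) (h : ∀ x, fderiv ℝ p x = ω x) (x v w : Fin 3 → ℝ) :
    fderiv ℝ ω x v w = fderiv ℝ ω x w v := by
  have hd : Differentiable ℝ ω := hω.differentiable (by norm_num)
  have hc : Continuous (fderiv ℝ ω) := hω.continuous_fderiv (by norm_num)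
  set S : Set (Fin 3 → ℝ) := {x | ω x ≠ 0} with hS
  have hSo : IsOpen S := isOpen_ne_fun hω.continuous continuous_const
  have hsymS : ∀ y ∈ S, fderiv ℝ ω y v w = fderiv ℝ ω y w v := by
    intro y hy
    refine second_derivative_symmetric_of_eventually (𝕜 := ℝ) (f := p) (f' := ω) ?_
      (hd y).hasFDerivAt v w
    filter_upwards [hSo.mem_nhds hy] with z hz
    rw [← h z]
    refine DifferentiableAt.hasFDerivAt ?_
    by_contra hcon
    exact hz (by rw [← h z, fderiv_zero_of_not_differentiableAt hcon])
  by_cases hx : x ∈ closure S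
  · have hcl : IsClosed {y | fderiv ℝ ω y v w = fderiv ℝ ω y w v} :=
      isClosed_eq ((hc.clm_apply continuous_const).clm_apply continuous_const)
        ((hc.clm_apply continuous_const).clm_apply continuous_const)
    exact closure_minimal (s := S) hsymS hcl hx
  · have : ω =ᶠ[nhds x] fun _ => 0 := by
      filter_upwards [isClosed_closure.isOpen_compl.mem_nhds hx] with z hz
      by_contra hcon
      exact hz (subset_closure hcon)
    rw [this.fderiv_eq]
    simp

lemma potential_exists (ω : (Fin 3 → ℝ) × ℝ → (Fin 3 → ℝ) →L[ℝ] ℝ) (hω : ContDiff ℝ 1 ω)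
    (hsym : ∀ s x v w, fderiv ℝ (fun y => ω (y, s)) x v w = fderiv ℝ (fun y => ω (y, s)) x w v) :
    ∃ P : (Fin 3 → ℝ) × ℝ → ℝ, Continuous P ∧
      ∀ y s, HasFDerivAt (fun y => P (y, s)) (ω (y, s)) y := by
  refine ⟨fun q => ∫ τ in (0:ℝ)..1, ω (τ • q.1, q.2) q.1, ?_, ?_⟩
  · apply intervalIntegral.continuous_parametric_intervalIntegral_of_continuous'
    have hc := hω.continuous
    have : Continuous fun z : ((Fin 3 → ℝ) × ℝ) × ℝ => ω (z.2 • z.1.1, z.1.2) :=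
      hc.comp (by fun_prop)
    exact this.clm_apply (by fun_prop)
  · intro y s
    have hd : Differentiable ℝ fun y => ω (y, s) :=
      (hω.differentiable (by norm_num)).comp (by fun_prop)
    have := (convex_univ (𝕜 := ℝ) (E := Fin 3 → ℝ)
      ).hasFDerivWithinAt_curveIntegral_segment_of_hasFDerivWithinAt_symmetric
      (ω := fun y => ω (y, s)) (dω := fderiv ℝ (fun y => ω (y, s))) (a := 0) (b := y)
      (fun x _ => (hd x).hasFDerivAt.hasFDerivWithinAt)
      (fun a _ v _ w _ => hsym s a v w) (mem_univ _) (mem_univ _)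
    rw [hasFDerivWithinAt_univ] at this
    simp only [curveIntegral_segment] at this
    simpa [AffineMap.lineMap_apply] using! this

lemma weber_part2 (Ω : ℝ) (u : (Fin 3 → ℝ) → ℝ → Fin 3 → ℝ)
    (hu : ContDiff ℝ 2 (fun q : (Fin 3 → ℝ) × ℝ => u q.1 q.2))
    (p : (Fin 3 → ℝ) → ℝ → ℝ) (X A : (Fin 3 → ℝ) → ℝ → Fin 3 → ℝ)
    (hE : ∀ x t, RotEuler Ω u p x t)
    (hX : IsFlowMap u X 0) (hA : IsInverseOf A X) :
    ∃ r : (Fin 3 → ℝ) → ℝ → ℝ, Weber Ω u A r := by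
  set U : (Fin 3 → ℝ) × ℝ → Fin 3 → ℝ := fun q => u q.1 q.2 with hU
  have hu' : ∀ i, ContDiff ℝ 2 (fun q => U q i) := fun i => contDiff_pi.1 hu i
  have hud : ∀ i, Differentiable ℝ (fun q => U q i) := fun i => (hu' i).differentiable (by norm_num)
  have hUd : Differentiable ℝ U := hu.differentiable (by norm_num)
  have hUc : Continuous U := hu.continuous
  have hUcomp : ∀ q w j, fderiv ℝ U q w j = fderiv ℝ (fun q => U q j) q w := by
    intro q w j
    rw [fderiv_apply (hUd q)]
    rfl
  have hD1 : ContDiff ℝ 1 (fderiv ℝ U) := hu.fderiv_right (m := 1) (by norm_num)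
  have hU1 : ContDiff ℝ 1 U := hu.of_le (by norm_num)
  -- acceleration
  set a : (Fin 3 → ℝ) × ℝ → Fin 3 → ℝ := fun q => fderiv ℝ U q (U q, 1) with ha
  have ha1 : ContDiff ℝ 1 a := hD1.clm_apply (hU1.prodMk contDiff_const)
  have hD : ∀ y s i, deriv (fun s => u y s i) s + ∑ j, u y s j * pd j (fun y => u y s i) y
      = a (y, s) i := by
    intro y s i
    rw [deriv_slice (g := fun q => U q i) (hud i _)]
    have hpdU : ∀ j, pd j (fun y => u y s i) y
        = fderiv ℝ (fun q => U q i) (y, s) (ee j, 0) :=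
      fun j => pd_slice (g := fun q => U q i) (hud i _) j
    simp only [ha, hUcomp, hpdU]
    rw [clm_mat (fderiv ℝ (fun q => U q i) (y, s)) (U (y, s))]
    rfl
  let ω : (Fin 3 → ℝ) × ℝ → (Fin 3 → ℝ) →L[ℝ] ℝ := fun q =>
    ∑ i, (-(a q i + 2 * Ω * (U q 0 * ee i 1 - U q 1 * ee i 0))) •
      ContinuousLinearMap.proj (R := ℝ) (φ := fun _ : Fin 3 => ℝ) i
  have hω1 : ContDiff ℝ 1 ω := by
    refine ContDiff.sum fun i _ => ContDiff.fun_smul ?_ contDiff_const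
    have h0 := contDiff_pi.1 hU1 0
    have h1 := contDiff_pi.1 hU1 1
    have h2 := contDiff_pi.1 ha1 i
    fun_prop
  have hωv : ∀ q v, ω q v = -(∑ i, v i * a q i) - 2 * Ω * (U q 0 * v 1 - U q 1 * v 0) := by
    intro q v
    simp [ω, Fin.sum_univ_three, ee]
    ring
  have hpω : ∀ s y, fderiv ℝ (fun y => p y s) y = ω (y, s) := by
    intro s y
    ext v
    rw [clm_sum (fderiv ℝ (fun y => p y s) y), clm_sum (ω (y, s))]
    refine Finset.sum_congr rfl fun i _ => ?_
    congr 1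
    have h1 := hE y s i
    rw [hD, cross_e2] at h1
    have h2 : pd i (fun y => p y s) y = fderiv ℝ (fun y => p y s) y (ee i) := rfl
    have h3 : ∑ j, ee i j * a (y, s) j = a (y, s) i := by
      fin_cases i <;> simp [ee]
    have h4 : ∀ k, u y s k = U (y, s) k := fun k => rfl
    rw [hωv, h3, ← h2]
    rw [h4, h4] at h1
    linarith
  obtain ⟨P, hPc, hP⟩ := potential_exists ω hω1 (fun s x v w =>
    curl_sym (fun y => p y s) (fun y => ω (y, s)) (hω1.comp (by fun_prop)) (hpω s) x v w)
  -- Lagrangian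
  let Q : (Fin 3 → ℝ) × ℝ → ℝ := fun q =>
    (1/2) * ∑ j, (U q j)^2 + Ω * (q.1 0 * U q 1 - q.1 1 * U q 0)
  have hQ2 : ContDiff ℝ 1 Q := by
    have h0 := contDiff_pi.1 hU1 0
    have h1 := contDiff_pi.1 hU1 1
    have h2 := contDiff_pi.1 hU1 2
    simp only [Q, Fin.sum_univ_three]
    fun_prop
  have hQd : Differentiable ℝ Q := hQ2.differentiable (by norm_num)
  have hQv : ∀ q w, fderiv ℝ Q q (w, 0) = ∑ j, U q j * fderiv ℝ U q (w, 0) j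
      + Ω * (w 0 * U q 1 + q.1 0 * fderiv ℝ U q (w, 0) 1
        - w 1 * U q 0 - q.1 1 * fderiv ℝ U q (w, 0) 0) := by
    intro q w
    have hx : ∀ k, HasFDerivAt (fun q : (Fin 3 → ℝ) × ℝ => q.1 k)
        ((ContinuousLinearMap.proj k).comp (ContinuousLinearMap.fst ℝ (Fin 3 → ℝ) ℝ)) q :=
      fun k => ((ContinuousLinearMap.proj (R := ℝ) (φ := fun _ : Fin 3 => ℝ) k).comp
        (ContinuousLinearMap.fst ℝ (Fin 3 → ℝ) ℝ)).hasFDerivAt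
    have h2 := HasFDerivAt.fun_sum (u := Finset.univ) (x := q) (fun j (_ : j ∈ Finset.univ) =>
      (hud j q).hasFDerivAt.pow 2)
    have h3 := (((hx 0).mul (hud 1 q).hasFDerivAt).sub ((hx 1).mul (hud 0 q).hasFDerivAt)).const_mul Ω
    have h4 := (h2.const_mul (1/2)).add h3
    have h6 := congrArg (fun T => T (w, (0:ℝ))) h4.fderiv
    refine h6.trans ?_
    simp [Fin.sum_univ_three, hUcomp]
    ring
  let L : (Fin 3 → ℝ) × ℝ → ℝ := fun q => P q - Q q
  have hLc : Continuous L := hPc.sub hQ2.continuous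
  let L' : (Fin 3 → ℝ) × ℝ → (Fin 3 → ℝ) →L[ℝ] ℝ := fun q =>
    ω q - (fderiv ℝ Q q).comp (ContinuousLinearMap.inl ℝ _ ℝ)
  have hL' : ∀ y s, HasFDerivAt (fun y => L (y, s)) (L' (y, s)) y := fun y s =>
    (hP y s).sub (hasFDerivAt_slice (hQd (y, s)).hasFDerivAt)
  have hL'c : Continuous L' := hω1.continuous.sub
    ((hQ2.continuous_fderiv (by norm_num)).clm_comp continuous_const)
  refine ⟨fun x t => -∫ σ in (0:ℝ)..1, (-t) * L (X (A x t) (t * (1 - σ)), t * (1 - σ)), ?_⟩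
  intro x₀ t i
  set c : ℝ := -t with hc
  let τ : ℝ → ℝ := fun σ => t * (1 - σ)
  have hτ : ∀ σ, HasDerivAt τ c σ := by
    intro σ
    have := ((hasDerivAt_id σ).const_sub 1).const_mul t
    simpa [τ, hc] using! this
  have hτc : Continuous τ := by fun_prop
  let y : (Fin 3 → ℝ) → ℝ → Fin 3 → ℝ := fun x σ => X (A x t) (τ σ)
  have hy : ∀ x σ, HasDerivAt (y x) (c • U (y x σ, τ σ)) σ := fun x σ =>
    (hX.2 (A x t) (τ σ)).scomp σ (hτ σ)
  have hyc : ∀ x, Continuous (y x) :=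
    fun x => continuous_iff_continuousAt.2 fun s => (hy x s).continuousAt
  let z : (Fin 3 → ℝ) → ℝ → ℝ := fun x σ => ∫ σ' in (0:ℝ)..σ, c * L (y x σ', τ σ')
  have hz : ∀ x σ, HasDerivAt (z x) (c * L (y x σ, τ σ)) σ := by
    intro x σ
    have hcont : Continuous fun σ' => c * L (y x σ', τ σ') :=
      continuous_const.mul (hLc.comp ((hyc x).prodMk hτc))
    exact hcont.integral_hasStrictDerivAt 0 σ |>.hasDerivAt
  let f : ℝ → (Fin 3 → ℝ) × ℝ → (Fin 3 → ℝ) × ℝ := fun σ q =>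
    (c • U (q.1, τ σ), c * L (q.1, τ σ))
  let f' : ℝ → (Fin 3 → ℝ) × ℝ → (Fin 3 → ℝ) × ℝ →L[ℝ] (Fin 3 → ℝ) × ℝ := fun σ q =>
    ((c • ((fderiv ℝ U (q.1, τ σ)).comp (ContinuousLinearMap.inl ℝ _ ℝ))).prod
      (c • L' (q.1, τ σ))).comp (ContinuousLinearMap.fst ℝ (Fin 3 → ℝ) ℝ)
  have hf : ∀ σ q, HasFDerivAt (f σ) (f' σ q) q := by
    intro σ q
    have h1 := (hasFDerivAt_slice (hUd (q.1, τ σ)).hasFDerivAt).const_smul c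
    have h2 := (hL' q.1 (τ σ)).const_mul c
    exact (h1.prodMk h2).comp q hasFDerivAt_fst
  have hf'c : Continuous fun q : ℝ × ((Fin 3 → ℝ) × ℝ) => f' q.1 q.2 := by
    have hpair : Continuous fun q : ℝ × ((Fin 3 → ℝ) × ℝ) => (q.2.1, τ q.1) := by fun_prop
    have h1 : Continuous fun q : ℝ × ((Fin 3 → ℝ) × ℝ) =>
        c • ((fderiv ℝ U (q.2.1, τ q.1)).comp (ContinuousLinearMap.inl ℝ (Fin 3 → ℝ) ℝ)) :=
      ((hD1.continuous.comp hpair).clm_comp continuous_const).const_smul c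
    have h2 : Continuous fun q : ℝ × ((Fin 3 → ℝ) × ℝ) => c • L' (q.2.1, τ q.1) :=
      (hL'c.comp hpair).const_smul c
    have h3 := (ContinuousLinearMap.prodₗᵢ (𝕜 := ℝ) (E := Fin 3 → ℝ)
      (F := Fin 3 → ℝ) (G := ℝ) ℝ).continuous.comp (h1.prodMk h2)
    exact h3.clm_comp continuous_const
  obtain ⟨Φ, hΦ0, hΦ, hΦd⟩ := flow_diff f f' hf hf'c (fun x σ => (y x σ, z x σ))
    (fun x σ => (hy x σ).prodMk (hz x σ)) (ContinuousLinearMap.inl ℝ _ ℝ)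
    (fun x => by simp [y, z, τ, hA.1]) x₀
  -- conserved quantity
  let w : ℝ → (Fin 3 → ℝ) × ℝ := fun σ => Φ σ (ee i)
  have hw : ∀ σ ∈ Icc (0:ℝ) 1, HasDerivWithinAt w
      (c • fderiv ℝ U (y x₀ σ, τ σ) ((w σ).1, 0), c * L' (y x₀ σ, τ σ) (w σ).1) (Icc 0 1) σ := by
    intro σ hσ
    have := (hΦ σ hσ).clm_apply (hasDerivWithinAt_const σ (Icc 0 1) (ee i))
    simpa [f'] using! this
  let I : ℝ → ℝ := fun σ => ∑ j, (w σ).1 j * U (y x₀ σ, τ σ) j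
    + Ω * (y x₀ σ 0 * (w σ).1 1 - y x₀ σ 1 * (w σ).1 0) + (w σ).2
  have hI : ∀ σ ∈ Icc (0:ℝ) 1, HasDerivWithinAt I 0 (Icc 0 1) σ := by
    intro σ hσ
    have hw1 := (hw σ hσ).fst
    have hw2 := (hw σ hσ).snd
    have hw1j := fun j => (hasDerivWithinAt_pi.1 hw1) j
    have hyj := fun j => (hasDerivAt_pi.1 (hy x₀ σ) j).hasDerivWithinAt (s := Icc (0:ℝ) 1)
    have hUU : HasDerivAt (fun σ => U (y x₀ σ, τ σ)) (c • a (y x₀ σ, τ σ)) σ := by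
      have := HasFDerivAt.comp_hasDerivAt σ (hUd (y x₀ σ, τ σ)).hasFDerivAt
        ((hy x₀ σ).prodMk (hτ σ))
      convert! this using 1
      simp only [ha]
      rw [← map_smul]
      simp
    have hUj := fun j => (hasDerivAt_pi.1 hUU j).hasDerivWithinAt (s := Icc (0:ℝ) 1)
    have hs := HasDerivWithinAt.fun_sum (u := Finset.univ) (x := σ)
      (fun j (_ : j ∈ Finset.univ) => (hw1j j).mul (hUj j))
    have hall := (hs.add ((((hyj 0).mul (hw1j 1)).sub ((hyj 1).mul (hw1j 0))).const_mul Ω)).add hw2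
    convert! hall using 1
    have hL'v : L' (y x₀ σ, τ σ) (w σ).1 = ω (y x₀ σ, τ σ) (w σ).1
        - fderiv ℝ Q (y x₀ σ, τ σ) ((w σ).1, 0) := by simp [L']
    simp only [hL'v, hωv, hQv, Fin.sum_univ_three, Pi.smul_apply, smul_eq_mul]
    ring
  have hconst := constant_of_has_deriv_right_zero (f := I) (a := 0) (b := 1)
    (fun σ hσ => (hI σ hσ).continuousWithinAt)
    (fun σ hσ => (hI σ (Ico_subset_Icc_self hσ)).mono_of_mem_nhdsWithin
        (Filter.mem_of_superset (Icc_mem_nhdsGE hσ.2) (Icc_subset_Icc_left hσ.1)))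
    1 (by simp)
  have h1 := hΦd 1 (by simp)
  have hτ1 : τ 1 = 0 := by simp [τ]
  have hτ0 : τ 0 = t := by simp [τ]
  have hy1 : ∀ x, y x 1 = A x t := fun x => by simp [y, hτ1, hX.1]
  have hy0 : ∀ x, y x 0 = x := fun x => by simp [y, hτ0, hA.1]
  have hAf : HasFDerivAt (fun x => A x t) ((ContinuousLinearMap.fst ℝ (Fin 3 → ℝ) ℝ).comp (Φ 1)) x₀ := by
    have := h1.fst
    simpa only [hy1] using! this
  have hzf : HasFDerivAt (fun x => z x 1) ((ContinuousLinearMap.snd ℝ (Fin 3 → ℝ) ℝ).comp (Φ 1)) x₀ :=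
    h1.snd
  have hpA : ∀ j, pd i (fun y => A y t j) x₀ = (w 1).1 j := by
    intro j
    rw [pd, (hasFDerivAt_pi'.1 hAf j).fderiv]
    rfl
  have hpr : pd i (fun x => -∫ σ in (0:ℝ)..1, (-t) * L (X (A x t) (t * (1 - σ)), t * (1 - σ))) x₀
      = -(w 1).2 := by
    rw [pd]
    have := hzf.neg.fderiv
    refine (congrArg (fun T => T (ee i)) this).trans ?_
    simp [w]
  have hw0 : w 0 = (ee i, 0) := by simp [w, hΦ0]
  have hsum : ∑ j, ee i j * U (x₀, t) j = U (x₀, t) i := by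
    fin_cases i <;> simp [ee]
  simp only [I, hτ1, hτ0, hy1, hy0, hw0, hsum] at hconst
  rw [hpr, det3_e2, det3_e2]
  simp only [hpA]
  have e1 : U (x₀, t) i = u x₀ t i := rfl
  have e2 : ∀ j, U (A x₀ t, 0) j = u (A x₀ t) 0 j := fun j => rfl
  simp only [e1, e2] at hconst
  linarith


/-- If the twice continuously differentiable divergence-free field `u`,
the solution `A` of the transport equation with `A(x,0)=x` and the scalar `r` satisfy the
Weber formula, then `u` solves the rotating Euler equations with pressure
`π = (∂ₜ + u·∇) r + ½|u|² + Ω (e₃; x; u)`; conversely, any twice continuously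
differentiable solution of the rotating Euler equations obeys the Weber formula
with its back-to-labels map `A` and some scalar `r`. -/
theorem statement0 (Ω : ℝ) (hΩ : 0 < Ω)
    (u : (Fin 3 → ℝ) → ℝ → Fin 3 → ℝ)
    (hu : ContDiff ℝ 2 (fun q : (Fin 3 → ℝ) × ℝ => u q.1 q.2))
    (hdiv : ∀ t, DivFree (fun y => u y t)) :
    (∀ (A : (Fin 3 → ℝ) → ℝ → Fin 3 → ℝ) (r : (Fin 3 → ℝ) → ℝ → ℝ),
      ContDiff ℝ 2 (fun q : (Fin 3 → ℝ) × ℝ => A q.1 q.2) →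
      ContDiff ℝ 2 (fun q : (Fin 3 → ℝ) × ℝ => r q.1 q.2) →
      SolvesTransport u A → Weber Ω u A r →
      ∀ x t, RotEuler Ω u (weberPressure Ω u r) x t)
    ∧
    (∀ (p : (Fin 3 → ℝ) → ℝ → ℝ) (X A : (Fin 3 → ℝ) → ℝ → Fin 3 → ℝ),
      (∀ x t, RotEuler Ω u p x t) →
      IsFlowMap u X 0 → IsInverseOf A X →
      ∃ r : (Fin 3 → ℝ) → ℝ → ℝ, Weber Ω u A r) := by
  exact ⟨fun A r hA hr hT hW x t => weber_part1 Ω u hu A r hA hr hT hW x t,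
    fun p X A hE hX hA => weber_part2 Ω u hu p X A hE hX hA⟩
end
end

section
/- Let u be a twice continuously differentiable solution of the rotating Euler equations ∂ₜu + (u·∇)u + ∇π + 2Ω e₃×u = 0, ∇·u = 0, with Lagrangian map X and back-to-labels map A(·,t) = X(·,t)⁻¹. Let ω = ∇×u be the relative vorticity, ω₀ = ω(·,0), and ζ(x,t) = ω₀(A(x,t)). Then the total vorticity satisfies the Cauchy invariance ω(x,t) + 2Ω e₃ = 𝒞(∇A(x,t); ζ(x,t) + 2Ω e₃), where for a 3×3 matrix M and vector w, 𝒞(M; w)ᵢ = ½ ε_{ijk} (M_{j·}; M_{k·}; w), M_{j·} denoting the j-th row of M (the vector ∂ⱼA in the case M = ∇A). -/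
open Real Set MeasureTheory

noncomputable section

theorem lin_exists {E : Type*} [NormedAddCommGroup E] [NormedSpace ℝ E] [CompleteSpace E]
    (B : ℝ → E →L[ℝ] E) (hB : Continuous B) (hb : ∀ τ ∈ Icc (0:ℝ) 1, ‖B τ‖ ≤ 1/2) :
    ∃ D : ℝ → E →L[ℝ] E, D 0 = 1 ∧
      ∀ τ ∈ Icc (0:ℝ) 1, HasDerivWithinAt D ((B τ) * (D τ)) (Icc 0 1) τ := by
  have h1 : ‖(1 : E →L[ℝ] E)‖ ≤ 1 := ContinuousLinearMap.norm_id_le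
  have hP : IsPicardLindelof (fun (t:ℝ) (D : E →L[ℝ] E) => B t * D)
      (⟨0, by simp⟩ : Icc (0:ℝ) 1) (1 : E →L[ℝ] E) 1 0 1 1 := by
    refine ⟨?_, ?_, ?_, ?_⟩
    · intro t ht
      apply LipschitzOnWith.of_dist_le_mul
      intro a _ b _
      rw [dist_eq_norm, dist_eq_norm, ← mul_sub]
      refine (norm_mul_le _ _).trans ?_
      have := hb t ht
      have h := norm_nonneg (a - b)
      push_cast
      nlinarith
    · intro a _
      fun_prop
    · intro t ht a ha
      refine (norm_mul_le _ _).trans ?_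
      have := hb t ht
      have h := norm_nonneg a
      have h2 : ‖a‖ ≤ 2 := by
        have h3 : ‖a - 1‖ ≤ 1 := by simpa [dist_eq_norm] using ha
        have := norm_add_le (a - 1) 1
        simp only [sub_add_cancel] at this
        linarith
      push_cast
      nlinarith
    · simp
  obtain ⟨D, h0, hD⟩ := hP.exists_eq_forall_mem_Icc_hasDerivWithinAt₀
  exact ⟨D, h0, hD⟩

theorem flow_fderiv {E : Type*} [NormedAddCommGroup E] [NormedSpace ℝ E]
    (v : E → ℝ → E) (G : E → ℝ → E →L[ℝ] E)
    (hG : Continuous (fun q : E × ℝ => G q.1 q.2))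
    (hv : ∀ z τ, HasFDerivAt (fun z => v z τ) (G z τ) z)
    (Z : E → ℝ → E) (hZ0 : ∀ y, Z y 0 = y)
    (hZ : ∀ y τ, HasDerivAt (Z y) (v (Z y τ) τ) τ) (x : E)
    (D : ℝ → E →L[ℝ] E) (hD0 : D 0 = 1)
    (hD : ∀ τ ∈ Icc (0:ℝ) 1, HasDerivWithinAt D (G (Z x τ) τ * D τ) (Icc 0 1) τ) :
    HasFDerivAt (fun y => Z y 1) (D 1) x := by
  have hZc : ∀ y, Continuous (Z y) := fun y =>
    continuous_iff_continuousAt.2 fun τ => (hZ y τ).continuousAt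
  have hLc : Continuous (fun τ => G (Z x τ) τ) :=
    hG.comp ((hZc x).prodMk continuous_id)
  obtain ⟨K, hK⟩ := (isCompact_Icc (a := (0:ℝ)) (b := 1)).exists_bound_of_continuousOn
    hLc.continuousOn
  have hK0 : 0 ≤ K := (norm_nonneg _).trans (hK 0 (by simp))
  -- uniform differentiability along the trajectory
  have stepA : ∀ η > 0, ∃ δ > 0, ∀ τ ∈ Icc (0:ℝ) 1, ∀ z, ‖z - Z x τ‖ ≤ δ →
      ‖v z τ - v (Z x τ) τ - G (Z x τ) τ (z - Z x τ)‖ ≤ η * ‖z - Z x τ‖ := by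
    intro η hη
    have hS : IsCompact ((fun τ => (Z x τ, τ)) '' Icc (0:ℝ) 1) :=
      isCompact_Icc.image ((hZc x).prodMk continuous_id)
    have h := hS.uniformContinuousAt_of_continuousAt (fun q : E × ℝ => G q.1 q.2)
      (fun a _ => hG.continuousAt) (Metric.dist_mem_uniformity hη)
    obtain ⟨δ, hδ, h⟩ := Metric.mem_uniformity_dist.1 h
    refine ⟨δ / 2, by positivity, fun τ hτ z hz => ?_⟩
    refine (convex_closedBall (Z x τ) (δ/2)).norm_image_sub_le_of_norm_hasFDerivWithin_le'
      (f := fun z => v z τ) (f' := fun z => G z τ)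
      (fun w _ => (hv w τ).hasFDerivWithinAt) (fun w hw => ?_) ?_ ?_
    · have := @h (Z x τ, τ) (w, τ) (by
        rw [Prod.dist_eq]; simp only [dist_self]
        rw [Metric.mem_closedBall, dist_comm] at hw
        exact max_lt (by linarith) hδ) ⟨τ, hτ, rfl⟩
      simp only [mem_ofPred_eq] at this
      rw [← dist_eq_norm, dist_comm]
      exact this.le
    · simp; positivity
    · simpa [dist_eq_norm] using hz
  have hder : ∀ y τ, HasDerivAt (fun τ => Z y τ - Z x τ) (v (Z y τ) τ - v (Z x τ) τ) τ :=
    fun y τ => (hZ y τ).sub (hZ x τ)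
  set C := exp (K + 1) with hC
  have hCpos : 0 < C := exp_pos _
  -- Lipschitz dependence
  obtain ⟨δ₁, hδ₁, h1⟩ := stepA 1 one_pos
  have stepB : ∀ y, ‖y - x‖ * C < δ₁ → ∀ τ ∈ Icc (0:ℝ) 1, ‖Z y τ - Z x τ‖ ≤ ‖y - x‖ * C := by
    intro y hy
    have gr : ∀ τ₂ ∈ Icc (0:ℝ) 1, (∀ τ ∈ Ico 0 τ₂, ‖Z y τ - Z x τ‖ ≤ δ₁) →
        ‖Z y τ₂ - Z x τ₂‖ ≤ ‖y - x‖ * C := by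
      intro τ₂ hτ₂ hin
      have := norm_le_gronwallBound_of_norm_deriv_right_le (f := fun τ => Z y τ - Z x τ)
        (f' := fun τ => v (Z y τ) τ - v (Z x τ) τ) (δ := ‖y - x‖) (K := K + 1) (ε := 0)
        (a := 0) (b := τ₂) ((hZc y).sub (hZc x)).continuousOn
        (fun τ _ => (hder y τ).hasDerivWithinAt) (by simp [hZ0]) (fun τ hτ => by
          have hτ' : τ ∈ Icc (0:ℝ) 1 := ⟨hτ.1, hτ.2.le.trans hτ₂.2⟩
          have e1 := h1 τ hτ' _ (hin τ hτ)
          have e2 := (G (Z x τ) τ).le_of_opNorm_le (hK τ hτ') (Z y τ - Z x τ)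
          have e3 := norm_le_norm_sub_add (v (Z y τ) τ - v (Z x τ) τ)
            (G (Z x τ) τ (Z y τ - Z x τ))
          linarith) τ₂ ⟨hτ₂.1, le_rfl⟩
      rw [gronwallBound_ε0] at this
      refine this.trans ?_
      gcongr
      rw [hC]
      apply exp_le_exp.2
      nlinarith [hτ₂.2, hτ₂.1]
    have key : ∀ τ ∈ Icc (0:ℝ) 1, ‖Z y τ - Z x τ‖ ≤ δ₁ := by
      by_contra! hcon
      have hcomp : IsCompact (Icc (0:ℝ) 1 ∩ {τ | δ₁ ≤ ‖Z y τ - Z x τ‖}) :=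
        isCompact_Icc.inter_right
          (isClosed_le continuous_const ((hZc y).sub (hZc x)).norm)
      obtain ⟨τ₀, hτ₀, hgt⟩ := hcon
      obtain ⟨τ₂, ⟨hm, hge⟩, hleast⟩ := hcomp.exists_isLeast ⟨τ₀, hτ₀, hgt.le⟩
      have := gr τ₂ hm (fun τ hτ => by
        by_contra! hc
        have := hleast ⟨⟨hτ.1, hτ.2.le.trans hm.2⟩, hc.le⟩
        exact absurd hτ.2 (not_lt.2 this))
      simp only [mem_ofPred_eq] at hge
      linarith
    intro τ hτ
    exact gr τ hτ (fun s hs => key s ⟨hs.1, hs.2.le.trans hτ.2⟩)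
  rw [hasFDerivAt_iff_isLittleO, Asymptotics.isLittleO_iff]
  intro ε hε
  set η := ε * (K + 1) / (C * C) with hη
  have hηpos : 0 < η := by positivity
  obtain ⟨δ₂, hδ₂, h2⟩ := stepA η hηpos
  have hnb : ∀ᶠ y in nhds x, ‖y - x‖ < min δ₁ δ₂ / C := by
    have : Metric.ball x (min δ₁ δ₂ / C) ∈ nhds x := Metric.ball_mem_nhds _ (by positivity)
    filter_upwards [this] with y hy
    simpa [dist_eq_norm] using hy
  filter_upwards [hnb] with y hy
  rw [lt_div_iff₀ hCpos, lt_min_iff] at hy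
  have hB := stepB y hy.1
  have hDy : ∀ τ ∈ Icc (0:ℝ) 1, HasDerivWithinAt (fun τ => Z y τ - Z x τ - D τ (y - x))
      (v (Z y τ) τ - v (Z x τ) τ - (G (Z x τ) τ) (D τ (y - x))) (Icc 0 1) τ := by
    intro τ hτ
    have := (hD τ hτ).clm_apply (hasDerivWithinAt_const τ (Icc 0 1) (y - x))
    simp only [map_zero, add_zero, mul_apply_eq_comp] at this
    exact (hder y τ).hasDerivWithinAt.sub this
  have := norm_le_gronwallBound_of_norm_deriv_right_le
        (f := fun τ => Z y τ - Z x τ - D τ (y - x))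
        (f' := fun τ => v (Z y τ) τ - v (Z x τ) τ - (G (Z x τ) τ) (D τ (y - x)))
        (δ := 0) (K := K + 1) (ε := η * (‖y - x‖ * C))
        (a := 0) (b := 1) (fun τ hτ => (hDy τ hτ).continuousWithinAt)
        (fun τ hτ => (hDy τ ⟨hτ.1, hτ.2.le⟩).mono_of_mem_nhdsWithin
          (Icc_mem_nhdsGE_of_mem hτ))
        (by simp [hZ0, hD0]) (fun τ hτ => by
          have hτ' : τ ∈ Icc (0:ℝ) 1 := ⟨hτ.1, hτ.2.le⟩
          have e1 := h2 τ hτ' (Z y τ) ((hB τ hτ').trans hy.2.le)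
          have e0 := mul_le_mul_of_nonneg_left (hB τ hτ') hηpos.le
          have e2 := (G (Z x τ) τ).le_of_opNorm_le (hK τ hτ') (Z y τ - Z x τ - D τ (y - x))
          have e3 := norm_add_le (v (Z y τ) τ - v (Z x τ) τ - G (Z x τ) τ (Z y τ - Z x τ))
            (G (Z x τ) τ (Z y τ - Z x τ - D τ (y - x)))
          have e4 : v (Z y τ) τ - v (Z x τ) τ - G (Z x τ) τ (Z y τ - Z x τ) +
            (G (Z x τ) τ (Z y τ - Z x τ - D τ (y - x))) =
              v (Z y τ) τ - v (Z x τ) τ - (G (Z x τ) τ) (D τ (y - x)) := by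
            rw [map_sub (G (Z x τ) τ) _ (D τ (y - x))]; abel
          rw [e4] at e3
          have e5 := norm_nonneg (Z y τ - Z x τ - D τ (y - x))
          linarith) 1 (by simp)
  rw [gronwallBound_of_K_ne_0 (by positivity)] at this
  refine this.trans ?_
  simp only [zero_mul, zero_add, sub_zero, mul_one]
  rw [← hC]
  have e : η * (‖y - x‖ * C) / (K + 1) * C = ε * ‖y - x‖ := by
    rw [hη]; field_simp
  rw [← e]
  gcongr
  linarith

theorem grad_symm {p : (Fin 3 → ℝ) → ℝ} {F : (Fin 3 → ℝ) → ((Fin 3 → ℝ) →L[ℝ] ℝ)}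
    (hF : ContDiff ℝ 1 F) (hp : ∀ x, fderiv ℝ p x = F x) (x v w : Fin 3 → ℝ) :
    fderiv ℝ F x v w = fderiv ℝ F x w v := by
  have hFc : Continuous F := hF.continuous
  have hdc : Continuous (fderiv ℝ F) := hF.continuous_fderiv (by simp)
  have hclosed : IsClosed {x | fderiv ℝ F x v w = fderiv ℝ F x w v} := by
    apply isClosed_eq <;> fun_prop
  have h1 : {x | F x ≠ 0} ⊆ {x | fderiv ℝ F x v w = fderiv ℝ F x w v} := by
    intro z hz
    have hev : ∀ᶠ y in nhds z, HasFDerivAt p (F y) y := by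
      have : {y | F y ≠ 0} ∈ nhds z := (isOpen_ne_fun hFc continuous_const).mem_nhds hz
      filter_upwards [this] with y hy
      rw [← hp y]
      apply DifferentiableAt.hasFDerivAt
      by_contra hc
      exact hy (by rw [← hp y, fderiv_zero_of_not_differentiableAt hc])
    exact second_derivative_symmetric_of_eventually hev
      ((hF.differentiable (by simp)) z).hasFDerivAt v w
  by_cases hx : x ∈ closure {x | F x ≠ 0}
  · exact closure_minimal h1 hclosed hx
  · have : F =ᶠ[nhds x] fun _ => 0 := by
      filter_upwards [isClosed_closure.isOpen_compl.mem_nhds hx] with y hy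
      by_contra hc
      exact hy (subset_closure hc)
    rw [this.fderiv_eq]
    simp

theorem det3_eq (a b c : Fin 3 → ℝ) : det3 a b c =
    a 0 * (b 1 * c 2 - b 2 * c 1) - a 1 * (b 0 * c 2 - b 2 * c 0)
      + a 2 * (b 0 * c 1 - b 1 * c 0) := by
  simp [det3, Matrix.det_fin_three]
  ring

theorem vec_eq (w : Fin 3 → ℝ) : w = w 0 • ee 0 + w 1 • ee 1 + w 2 • ee 2 := by
  ext i
  fin_cases i <;> simp [ee]

theorem clm_eq {F : Type*} [AddCommGroup F] [Module ℝ F] [TopologicalSpace F]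
    (L : (Fin 3 → ℝ) →L[ℝ] F) (w : Fin 3 → ℝ) :
    L w = w 0 • L (ee 0) + w 1 • L (ee 1) + w 2 • L (ee 2) := by
  conv_lhs => rw [vec_eq w]
  simp only [map_add, map_smul]

theorem det3_deriv (L : (Fin 3 → ℝ) →L[ℝ] (Fin 3 → ℝ))
    (htr : L (ee 0) 0 + L (ee 1) 1 + L (ee 2) 2 = 0) (a b c : Fin 3 → ℝ) :
    det3 (L a) b c + det3 a (L b) c + det3 a b (L c) = 0 := by
  rw [clm_eq L a, clm_eq L b, clm_eq L c]
  simp only [det3_eq, Pi.add_apply, Pi.smul_apply, smul_eq_mul]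
  linear_combination (a 0 * (b 1 * c 2 - b 2 * c 1) - a 1 * (b 0 * c 2 - b 2 * c 0)
      + a 2 * (b 0 * c 1 - b 1 * c 0)) * htr

theorem calC_eq (D : (Fin 3 → ℝ) →L[ℝ] (Fin 3 → ℝ)) (W W' : Fin 3 → ℝ)
    (h : ∀ b c, det3 (D b) (D c) W' = det3 b c W) (i : Fin 3) :
    calC (fun j => D (ee j)) W' i = W i := by
  simp only [calC, h, lev]
  fin_cases i <;> simp [Fin.sum_univ_three, det3_eq, ee] <;> ring

section vort

variable {u : (Fin 3 → ℝ) → ℝ → Fin 3 → ℝ}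

/-- Full space-time derivative. -/
def GG (u : (Fin 3 → ℝ) → ℝ → Fin 3 → ℝ) (q : (Fin 3 → ℝ) × ℝ) :
    (Fin 3 → ℝ) × ℝ →L[ℝ] (Fin 3 → ℝ) :=
  fderiv ℝ (fun q : (Fin 3 → ℝ) × ℝ => u q.1 q.2) q

/-- Spatial derivative. -/
def LL (u : (Fin 3 → ℝ) → ℝ → Fin 3 → ℝ) (z : Fin 3 → ℝ) (s : ℝ) :
    (Fin 3 → ℝ) →L[ℝ] (Fin 3 → ℝ) :=
  (GG u (z, s)).comp (ContinuousLinearMap.inl ℝ (Fin 3 → ℝ) ℝ)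

theorem LL_apply (z : Fin 3 → ℝ) (s : ℝ) (w : Fin 3 → ℝ) : LL u z s w = GG u (z, s) (w, 0) := by
  simp [LL]

theorem GG_contDiff (hu : ContDiff ℝ 2 (fun q : (Fin 3 → ℝ) × ℝ => u q.1 q.2)) :
    ContDiff ℝ 1 (GG u) := hu.fderiv_right (by norm_num)

theorem U_hasFDerivAt (hu : ContDiff ℝ 2 (fun q : (Fin 3 → ℝ) × ℝ => u q.1 q.2))
    (q : (Fin 3 → ℝ) × ℝ) :
    HasFDerivAt (fun q : (Fin 3 → ℝ) × ℝ => u q.1 q.2) (GG u q) q :=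
  (hu.differentiable (by norm_num) q).hasFDerivAt

theorem u_hasFDerivAt (hu : ContDiff ℝ 2 (fun q : (Fin 3 → ℝ) × ℝ => u q.1 q.2))
    (z : Fin 3 → ℝ) (s : ℝ) : HasFDerivAt (fun z => u z s) (LL u z s) z :=
  HasFDerivAt.comp (g := fun q : (Fin 3 → ℝ) × ℝ => u q.1 q.2) (f := fun z => (z, s)) z
    (U_hasFDerivAt hu (z, s)) (hasFDerivAt_prodMk_left z s)

theorem pd_u (hu : ContDiff ℝ 2 (fun q : (Fin 3 → ℝ) × ℝ => u q.1 q.2))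
    (z : Fin 3 → ℝ) (s : ℝ) (i j : Fin 3) :
    pd i (fun y => u y s j) z = LL u z s (ee i) j := by
  have := (hasFDerivAt_pi'.1 (u_hasFDerivAt hu z s) j).fderiv
  simp only [pd, this]
  rfl

theorem deriv_u (hu : ContDiff ℝ 2 (fun q : (Fin 3 → ℝ) × ℝ => u q.1 q.2))
    (z : Fin 3 → ℝ) (s : ℝ) (j : Fin 3) :
    deriv (fun s => u z s j) s = GG u (z, s) (0, 1) j := by
  have h : HasDerivAt (fun s => u z s) (GG u (z, s) (0, 1)) s :=
    (U_hasFDerivAt hu (z, s)).comp_hasDerivAt s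
      ((hasDerivAt_const s z).prodMk (hasDerivAt_id s))
  exact (hasDerivAt_pi.1 h j).deriv

theorem GG_symm (hu : ContDiff ℝ 2 (fun q : (Fin 3 → ℝ) × ℝ => u q.1 q.2))
    (q a b : (Fin 3 → ℝ) × ℝ) : fderiv ℝ (GG u) q a b = fderiv ℝ (GG u) q b a :=
  second_derivative_symmetric (fun y => U_hasFDerivAt hu y)
    ((GG_contDiff hu).differentiable (by norm_num) q).hasFDerivAt a b

/-- the linear map `w ↦ e₃ × w`. -/
def crossL : (Fin 3 → ℝ) →L[ℝ] (Fin 3 → ℝ) :=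
  LinearMap.toContinuousLinearMap
    { toFun := cross (ee 2)
      map_add' := fun x y => by ext i; fin_cases i <;> simp [cross, ee] <;> ring
      map_smul' := fun c y => by ext i; fin_cases i <;> simp [cross, ee] }

/-- the pairing of a vector with the coordinates, as a functional. -/
def dualL : (Fin 3 → ℝ) →L[ℝ] ((Fin 3 → ℝ) →L[ℝ] ℝ) :=
  ∑ j : Fin 3, (ContinuousLinearMap.proj (R := ℝ) (φ := fun _ : Fin 3 => ℝ) j).smulRight
    (ContinuousLinearMap.proj (R := ℝ) (φ := fun _ : Fin 3 => ℝ) j)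

theorem dualL_ee (v : Fin 3 → ℝ) (j : Fin 3) : dualL v (ee j) = v j := by
  fin_cases j <;> simp [dualL, Fin.sum_univ_three, ee]

theorem curl_euler (hu : ContDiff ℝ 2 (fun q : (Fin 3 → ℝ) × ℝ => u q.1 q.2))
    {Ω : ℝ} {p : (Fin 3 → ℝ) → ℝ → ℝ} (heuler : ∀ x t, RotEuler Ω u p x t)
    (x : Fin 3 → ℝ) (t : ℝ) (i j : Fin 3) :
    fderiv ℝ (GG u) (x, t) (ee i, 0) (u x t, 1) j + LL u x t (LL u x t (ee i)) j
      + 2 * Ω * cross (ee 2) (LL u x t (ee i)) j =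
    fderiv ℝ (GG u) (x, t) (ee j, 0) (u x t, 1) i + LL u x t (LL u x t (ee j)) i
      + 2 * Ω * cross (ee 2) (LL u x t (ee j)) i := by
  set a : (Fin 3 → ℝ) → (Fin 3 → ℝ) := fun y =>
    GG u (y, t) (u y t, 1) + (2 * Ω) • crossL (u y t) with ha
  have huy : ContDiff ℝ 2 (fun y => u y t) := hu.comp (by fun_prop : ContDiff ℝ 2 fun y => (y, t))
  have hac : ContDiff ℝ 1 a := by
    have h1 : ContDiff ℝ 1 (fun y => GG u (y, t)) :=
      (GG_contDiff hu).comp (by fun_prop : ContDiff ℝ 1 fun y => (y, t))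
    have h2 : ContDiff ℝ 1 (fun y => u y t) := huy.of_le (by norm_num)
    have h3 : ContDiff ℝ 1 (fun y => (u y t, (1:ℝ))) := h2.prodMk contDiff_const
    exact (h1.clm_apply h3).add ((crossL.contDiff.comp h2).const_smul (2 * Ω))
  have hFd : ContDiff ℝ 1 (fun y => - dualL (a y)) := (dualL.contDiff.comp hac).neg
  have hp : ∀ y, fderiv ℝ (fun y => p y t) y = - dualL (a y) := by
    intro y
    have hc : ∀ k, fderiv ℝ (fun y => p y t) y (ee k) = (- dualL (a y)) (ee k) := by
      intro k
      have h := heuler y t k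
      simp only [deriv_u hu, pd_u hu] at h
      have e : (∑ j, u y t j * LL u y t (ee j) k) = LL u y t (u y t) k := by
        rw [clm_eq (LL u y t) (u y t)]
        simp [Fin.sum_univ_three]
      rw [e, LL_apply] at h
      have e2 : GG u (y, t) (u y t, 1) = GG u (y, t) (0, 1) + GG u (y, t) (u y t, 0) := by
        rw [← map_add]; simp
      have e3 : crossL (u y t) k = cross (ee 2) (u y t) k := rfl
      simp only [neg_apply, dualL_ee, ha, e2, Pi.add_apply, Pi.smul_apply,
        smul_eq_mul, e3]
      simp only [pd] at h
      linarith
    ext w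
    rw [clm_eq (fderiv ℝ (fun y => p y t) y) w, clm_eq (- dualL (a y)) w, hc, hc, hc]
  have had : HasFDerivAt a (fderiv ℝ a x) x :=
    (hac.differentiable (by norm_num) x).hasFDerivAt
  have hval : ∀ w, fderiv ℝ a x w = fderiv ℝ (GG u) (x, t) (w, 0) (u x t, 1)
      + LL u x t (LL u x t w) + (2 * Ω) • crossL (LL u x t w) := by
    intro w
    have h1 : HasFDerivAt (fun y => GG u (y, t))
        ((fderiv ℝ (GG u) (x, t)).comp (ContinuousLinearMap.inl ℝ (Fin 3 → ℝ) ℝ)) x :=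
      ((GG_contDiff hu).differentiable (by norm_num) (x, t)).hasFDerivAt.comp x
        (hasFDerivAt_prodMk_left x t)
    have h2 := u_hasFDerivAt hu x t
    have h3 := h2.prodMk (hasFDerivAt_const (1:ℝ) x)
    have h4 := (h1.clm_apply h3).add ((crossL.hasFDerivAt.comp x h2).const_smul (2 * Ω))
    have h5 : HasFDerivAt a _ x := h4
    rw [h5.fderiv]
    simp [LL_apply]
    abel
  have hs := grad_symm hFd hp x (ee i) (ee j)
  have hdF : HasFDerivAt (fun y => - dualL (a y)) (-(dualL.comp (fderiv ℝ a x))) x :=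
    (dualL.hasFDerivAt.comp x had).neg
  rw [hdF.fderiv] at hs
  simp only [neg_apply, ContinuousLinearMap.comp_apply, dualL_ee, hval] at hs
  have := neg_injective hs
  simpa [crossL] using this

/-- total vorticity along a trajectory. -/
def WW (Ω : ℝ) (u : (Fin 3 → ℝ) → ℝ → Fin 3 → ℝ) (z : Fin 3 → ℝ) (s : ℝ) : Fin 3 → ℝ :=
  fun m => curl (fun y => u y s) z m + 2 * Ω * ee 2 m

theorem trace_zero (hu : ContDiff ℝ 2 (fun q : (Fin 3 → ℝ) × ℝ => u q.1 q.2))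
    (hdiv : ∀ t, DivFree (fun y => u y t)) (z : Fin 3 → ℝ) (s : ℝ) :
    LL u z s (ee 0) 0 + LL u z s (ee 1) 1 + LL u z s (ee 2) 2 = 0 := by
  have := hdiv s z
  simpa only [pd_u hu, Fin.sum_univ_three] using this

theorem WW_deriv (hu : ContDiff ℝ 2 (fun q : (Fin 3 → ℝ) × ℝ => u q.1 q.2))
    {Ω : ℝ} {p : (Fin 3 → ℝ) → ℝ → ℝ} (heuler : ∀ x t, RotEuler Ω u p x t)
    (hdiv : ∀ t, DivFree (fun y => u y t)) (γ : ℝ → Fin 3 → ℝ)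
    (hγ : ∀ s, HasDerivAt γ (u (γ s) s) s) (s : ℝ) :
    HasDerivAt (fun s => WW Ω u (γ s) s) (LL u (γ s) s (WW Ω u (γ s) s)) s := by
  have hg : ∀ i j, HasDerivAt (fun s => LL u (γ s) s (ee i) j)
      (fderiv ℝ (GG u) (γ s, s) (ee i, 0) (u (γ s) s, 1) j) s := by
    intro i j
    have h1 : HasDerivAt (fun s => GG u (γ s, s)) (fderiv ℝ (GG u) (γ s, s) (u (γ s) s, 1)) s :=
      HasFDerivAt.comp_hasDerivAt (f := fun s => (γ s, s)) s
        ((GG_contDiff hu).differentiable (by norm_num) (γ s, s)).hasFDerivAt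
        ((hγ s).prodMk (hasDerivAt_id s))
    have h2 := h1.clm_apply (hasDerivAt_const s ((ee i, 0) : (Fin 3 → ℝ) × ℝ))
    simp only [map_zero, add_zero] at h2
    rw [GG_symm hu] at h2
    simpa only [LL_apply] using hasDerivAt_pi.1 h2 j
  have htr := trace_zero hu hdiv (γ s) s
  have hc := fun i j => curl_euler hu heuler (γ s) s i j
  have c01 := hc 0 1
  have c12 := hc 1 2
  have c20 := hc 2 0
  rw [clm_eq (LL u (γ s) s) (LL u (γ s) s (ee 0)), clm_eq (LL u (γ s) s) (LL u (γ s) s (ee 1))]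
    at c01
  rw [clm_eq (LL u (γ s) s) (LL u (γ s) s (ee 1)), clm_eq (LL u (γ s) s) (LL u (γ s) s (ee 2))]
    at c12
  rw [clm_eq (LL u (γ s) s) (LL u (γ s) s (ee 2)), clm_eq (LL u (γ s) s) (LL u (γ s) s (ee 0))]
    at c20
  rw [hasDerivAt_pi]
  rw [clm_eq (LL u (γ s) s) (WW Ω u (γ s) s)]
  simp only [WW, curl, pd_u hu]
  intro m
  fin_cases m
  · refine (((hg 1 2).sub (hg 2 1)).add_const (2 * Ω * ee 2 0)).congr_deriv ?_
    simp [ee, cross] at c12 htr ⊢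
    linear_combination c12 + (LL u (γ s) s (ee 2) 1 - LL u (γ s) s (ee 1) 2) * htr
  · refine (((hg 2 0).sub (hg 0 2)).add_const (2 * Ω * ee 2 1)).congr_deriv ?_
    simp [ee, cross] at c20 htr ⊢
    linear_combination c20 + (LL u (γ s) s (ee 0) 2 - LL u (γ s) s (ee 2) 0) * htr
  · refine (((hg 0 1).sub (hg 1 0)).add_const (2 * Ω * ee 2 2)).congr_deriv ?_
    simp [ee, cross] at c01 htr ⊢
    linear_combination c01 + (LL u (γ s) s (ee 1) 0 - LL u (γ s) s (ee 0) 1 - 2 * Ω) * htr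

end vort

/-- The local transport property between two times along the trajectory of `a`. -/
def PP (W : ℝ → Fin 3 → ℝ) (X A : (Fin 3 → ℝ) → ℝ → Fin 3 → ℝ) (a : Fin 3 → ℝ)
    (s s' : ℝ) : Prop :=
  ∃ D : (Fin 3 → ℝ) →L[ℝ] (Fin 3 → ℝ), HasFDerivAt (fun y => X (A y s) s') D (X a s) ∧
    ∀ b c, det3 (D b) (D c) (W s') = det3 b c (W s)

theorem PP_trans {W : ℝ → Fin 3 → ℝ} {X A : (Fin 3 → ℝ) → ℝ → Fin 3 → ℝ}
    (hA : IsInverseOf A X) {a : Fin 3 → ℝ} {s₁ s₂ s₃ : ℝ}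
    (h1 : PP W X A a s₁ s₂) (h2 : PP W X A a s₂ s₃) : PP W X A a s₁ s₃ := by
  obtain ⟨D1, hd1, hw1⟩ := h1
  obtain ⟨D2, hd2, hw2⟩ := h2
  refine ⟨D2.comp D1, ?_, fun b c => ?_⟩
  · have e : X (A (X a s₁) s₁) s₂ = X a s₂ := by rw [hA.2]
    have := HasFDerivAt.comp (g := fun y => X (A y s₂) s₃) (f := fun y => X (A y s₁) s₂)
      (X a s₁) (by rw [e]; exact hd2) hd1
    refine this.congr_of_eventuallyEq (Filter.Eventually.of_forall fun y => ?_)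
    simp [hA.2]
  · simp only [ContinuousLinearMap.comp_apply]
    rw [hw2, hw1]

theorem LL_cont {u : (Fin 3 → ℝ) → ℝ → Fin 3 → ℝ}
    (hu : ContDiff ℝ 2 (fun q : (Fin 3 → ℝ) × ℝ => u q.1 q.2)) :
    Continuous (fun q : (Fin 3 → ℝ) × ℝ => LL u q.1 q.2) := by
  have := (GG_contDiff hu).continuous
  unfold LL
  exact this.clm_comp continuous_const

theorem PP_short {Ω : ℝ} {u : (Fin 3 → ℝ) → ℝ → Fin 3 → ℝ} {p : (Fin 3 → ℝ) → ℝ → ℝ}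
    {X A : (Fin 3 → ℝ) → ℝ → Fin 3 → ℝ}
    (hu : ContDiff ℝ 2 (fun q : (Fin 3 → ℝ) × ℝ => u q.1 q.2))
    (hdiv : ∀ t, DivFree (fun y => u y t))
    (heuler : ∀ x t, RotEuler Ω u p x t)
    (hX : IsFlowMap u X 0) (hA : IsInverseOf A X) (a : Fin 3 → ℝ) (s c : ℝ)
    (hb : ∀ τ ∈ Icc (0:ℝ) 1, ‖c • LL u (X a (s + c * τ)) (s + c * τ)‖ ≤ 1 / 2) :
    PP (fun s => WW Ω u (X a s) s) X A a s (s + c) := by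
  have hXc : Continuous (X a) :=
    continuous_iff_continuousAt.2 fun τ => (hX.2 a τ).continuousAt
  have haff : ∀ τ : ℝ, HasDerivAt (fun τ => s + c * τ) c τ := fun τ => by
    simpa using ((hasDerivAt_id τ).const_mul c).const_add s
  have hBc : Continuous (fun τ : ℝ => c • LL u (X a (s + c * τ)) (s + c * τ)) := by
    have h1 : Continuous fun τ : ℝ => (X a (s + c * τ), s + c * τ) := by fun_prop
    exact ((LL_cont hu).comp h1).const_smul c
  obtain ⟨D, hD0, hD⟩ := lin_exists _ hBc hb
  have hx : A (X a s) s = a := hA.2 a s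
  refine ⟨D 1, ?_, fun b d => ?_⟩
  · have h := flow_fderiv (fun z τ => c • u z (s + c * τ)) (fun z τ => c • LL u z (s + c * τ))
      (by
        have h1 : Continuous fun q : (Fin 3 → ℝ) × ℝ => (q.1, s + c * q.2) := by fun_prop
        exact ((LL_cont hu).comp h1).const_smul c)
      (fun z τ => (u_hasFDerivAt hu z _).const_smul c)
      (fun y τ => X (A y s) (s + c * τ)) (fun y => by simp [hA.1])
      (fun y τ => HasDerivAt.scomp τ (hX.2 (A y s) (s + c * τ)) (haff τ))
      (X a s) D hD0 (fun τ hτ => by simpa only [hx] using hD τ hτ)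
    simpa using h
  · have hW : ∀ τ : ℝ, HasDerivAt (fun τ => WW Ω u (X a (s + c * τ)) (s + c * τ))
        ((c • LL u (X a (s + c * τ)) (s + c * τ)) (WW Ω u (X a (s + c * τ)) (s + c * τ))) τ :=
      fun τ => HasDerivAt.scomp (g₁ := fun s => WW Ω u (X a s) s) τ
        (WW_deriv hu heuler hdiv (X a) (hX.2 a) (s + c * τ)) (haff τ)
    have hDb : ∀ b, ∀ τ ∈ Icc (0:ℝ) 1, HasDerivWithinAt (fun τ => D τ b)
        ((c • LL u (X a (s + c * τ)) (s + c * τ)) (D τ b)) (Icc 0 1) τ := by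
      intro b τ hτ
      have := (hD τ hτ).clm_apply (hasDerivWithinAt_const τ (Icc 0 1) b)
      simpa only [map_zero, add_zero, mul_apply_eq_comp] using this
    have hdet : ∀ τ ∈ Icc (0:ℝ) 1, HasDerivWithinAt
        (fun τ => det3 (D τ b) (D τ d) (WW Ω u (X a (s + c * τ)) (s + c * τ))) 0 (Icc 0 1) τ := by
      intro τ hτ
      have f := fun i => hasDerivWithinAt_pi.1 (hDb b τ hτ) i
      have g := fun i => hasDerivWithinAt_pi.1 (hDb d τ hτ) i
      have k := fun i => hasDerivWithinAt_pi.1 ((hW τ).hasDerivWithinAt (s := Icc 0 1)) i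
      have h := (((f 0).mul (((g 1).mul (k 2)).sub ((g 2).mul (k 1)))).sub
        ((f 1).mul (((g 0).mul (k 2)).sub ((g 2).mul (k 0))))).add
        ((f 2).mul (((g 0).mul (k 1)).sub ((g 1).mul (k 0))))
      have htr := trace_zero hu hdiv (X a (s + c * τ)) (s + c * τ)
      have h0 := det3_deriv (c • LL u (X a (s + c * τ)) (s + c * τ))
        (by simp only [ContinuousLinearMap.smul_apply, Pi.smul_apply, smul_eq_mul]
            linear_combination c * htr)
        (D τ b) (D τ d) (WW Ω u (X a (s + c * τ)) (s + c * τ))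
      simp only [det3_eq] at h0 ⊢
      refine HasDerivWithinAt.congr_deriv h ?_
      rw [← h0]
      simp only [Pi.mul_apply, Pi.sub_apply]
      ring
    have := constant_of_has_deriv_right_zero (fun τ hτ => (hdet τ hτ).continuousWithinAt)
      (fun τ hτ => (hdet τ ⟨hτ.1, hτ.2.le⟩).mono_of_mem_nhdsWithin
          (Icc_mem_nhdsGE_of_mem hτ)) 1 (by simp)
    simpa [hD0] using this

theorem PP_all {Ω : ℝ} {u : (Fin 3 → ℝ) → ℝ → Fin 3 → ℝ} {p : (Fin 3 → ℝ) → ℝ → ℝ}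
    {X A : (Fin 3 → ℝ) → ℝ → Fin 3 → ℝ}
    (hu : ContDiff ℝ 2 (fun q : (Fin 3 → ℝ) × ℝ => u q.1 q.2))
    (hdiv : ∀ t, DivFree (fun y => u y t))
    (heuler : ∀ x t, RotEuler Ω u p x t)
    (hX : IsFlowMap u X 0) (hA : IsInverseOf A X) (a : Fin 3 → ℝ) (t : ℝ) :
    PP (fun s => WW Ω u (X a s) s) X A a t 0 := by
  have hXc : Continuous (X a) :=
    continuous_iff_continuousAt.2 fun τ => (hX.2 a τ).continuousAt
  have hLc : Continuous (fun τ : ℝ => LL u (X a (t - t * τ)) (t - t * τ)) := by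
    have h1 : Continuous fun τ : ℝ => (X a (t - t * τ), t - t * τ) := by fun_prop
    exact (LL_cont hu).comp h1
  obtain ⟨K, hK⟩ := (isCompact_Icc (a := (0:ℝ)) (b := 1)).exists_bound_of_continuousOn
    hLc.continuousOn
  have hK0 : 0 ≤ K := (norm_nonneg _).trans (hK 0 (by simp))
  obtain ⟨N, hN⟩ := exists_nat_gt (2 * |t| * K)
  have hN0 : (0:ℝ) < N := lt_of_le_of_lt (by positivity) hN
  have step : ∀ k : ℕ, k ≤ N → PP (fun s => WW Ω u (X a s) s) X A a t (t - t * (k / N)) := by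
    intro k
    induction k with
    | zero =>
      intro _
      have := PP_short hu hdiv heuler hX hA a t 0 (by simp)
      simpa using this
    | succ k ih =>
      intro hk
      refine PP_trans hA (ih (by omega)) ?_
      have := PP_short hu hdiv heuler hX hA a (t - t * (k / N)) (-(t / N)) (fun τ hτ => by
        have e : t - t * (k / N) + -(t / N) * τ = t - t * ((k + τ) / N) := by ring
        have hk' : (k:ℝ) + 1 ≤ N := by exact_mod_cast hk
        have hb := hK ((k + τ) / N) ⟨by have := hτ.1; positivity, by
          rw [div_le_one hN0]; linarith [hτ.2]⟩
        rw [e, norm_smul, norm_neg, norm_div, Real.norm_eq_abs, Real.norm_eq_abs,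
          abs_of_pos hN0]
        calc |t| / N * _ ≤ |t| / N * K := by gcongr
          _ ≤ 1 / 2 := by
            rw [div_mul_eq_mul_div, div_le_div_iff₀ hN0 two_pos]
            linarith)
      have e : t - t * (k / N) + -(t / N) = t - t * ((k + 1 : ℕ) / N) := by push_cast; ring
      rwa [e] at this
  have := step N le_rfl
  rwa [div_self hN0.ne', mul_one, sub_self] at this

/-- Cauchy invariance for the rotating Euler equations: the total
vorticity satisfies `ω + 2Ω e₃ = 𝒞(∇A; ζ + 2Ω e₃)`, where `ζ(x,t) = ω₀(A(x,t))` and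
`A` is the back-to-labels map. -/
theorem statement2 (Ω : ℝ) (hΩ : 0 < Ω)
    (u : (Fin 3 → ℝ) → ℝ → Fin 3 → ℝ) (p : (Fin 3 → ℝ) → ℝ → ℝ)
    (X A : (Fin 3 → ℝ) → ℝ → Fin 3 → ℝ)
    (hu : ContDiff ℝ 2 (fun q : (Fin 3 → ℝ) × ℝ => u q.1 q.2))
    (hdiv : ∀ t, DivFree (fun y => u y t))
    (heuler : ∀ x t, RotEuler Ω u p x t)
    (hX : IsFlowMap u X 0) (hA : IsInverseOf A X) :
    ∀ x t i,
      curl (fun y => u y t) x i + 2 * Ω * ee 2 i =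
        calC (grad (fun y => A y t) x)
          (fun m => curl (fun y => u y 0) (A x t) m + 2 * Ω * ee 2 m) i := by
  intro x t i
  obtain ⟨D, hD, hw⟩ := PP_all hu hdiv heuler hX hA (A x t) t
  rw [hA.1] at hD
  have hAeq : (fun y => X (A y t) 0) = fun y => A y t := by
    funext y
    exact hX.1 _
  rw [hAeq] at hD
  have hg : grad (fun y => A y t) x = fun j => D (ee j) := by
    funext j k
    have := (hasFDerivAt_pi'.1 hD k).fderiv
    simp only [grad, pd, this]
    rfl
  simp only [hA.1, hX.1] at hw
  rw [hg]
  exact (calC_eq D _ _ hw i).symm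
end
end

section
/- Let ℓ : ℝ³ → ℝ³ be a continuously differentiable vector field and define ℛ(ℓ) componentwise by ℛ(ℓ)ᵢ = ½ ε_{ijk} [(e₃; ∂ⱼℓ; ∂ₖℓ) + (e₃; eⱼ; ∂ₖℓ) + (e₃; ∂ⱼℓ; eₖ)]. Then ℛ(ℓ) = −∂₃ℓ + (∇·ℓ) e₃ + ∇ℓ₁ × ∇ℓ₂, where ℓ = (ℓ₁, ℓ₂, ℓ₃), ∂₃ is the partial derivative in the third (vertical) coordinate, and × is the cross product in ℝ³. -/
open Real Set MeasureTheory

noncomputable section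

/-- For a `C¹` vector field `ℓ` on `ℝ³`, the quantity
`ℛ(ℓ)ᵢ = ½ ε_{ijk} [(e₃; ∂ⱼℓ; ∂ₖℓ) + (e₃; eⱼ; ∂ₖℓ) + (e₃; ∂ⱼℓ; eₖ)]`
equals `−∂₃ℓ + (∇·ℓ) e₃ + ∇ℓ₁ × ∇ℓ₂`. -/
theorem statement3 (ℓ : (Fin 3 → ℝ) → Fin 3 → ℝ) (hℓ : ContDiff ℝ 1 ℓ)
    (x : Fin 3 → ℝ) (i : Fin 3) :
    (1/2) * ∑ j, ∑ k, lev i j k *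
        (det3 (ee 2) (fun m => pd j (fun y => ℓ y m) x) (fun m => pd k (fun y => ℓ y m) x)
          + det3 (ee 2) (ee j) (fun m => pd k (fun y => ℓ y m) x)
          + det3 (ee 2) (fun m => pd j (fun y => ℓ y m) x) (ee k))
      = - pd 2 (fun y => ℓ y i) x
        + (∑ m, pd m (fun y => ℓ y m) x) * ee 2 i
        + cross (fun j => pd j (fun y => ℓ y 0) x) (fun j => pd j (fun y => ℓ y 1) x) i := by
  generalize hP : (fun j m => pd j (fun y => ℓ y m) x) = P
  have h : ∀ j m, pd j (fun y => ℓ y m) x = P j m := fun j m => by rw [← hP]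
  simp only [h]
  clear h hP
  fin_cases i <;>
    simp [lev, det3, ee, cross, Matrix.det_fin_three, Fin.sum_univ_three] <;> ring
end
end
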